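/- arXiv:1204.5213 — 6 statements merged into one kernel-verified Lean document; each statement's English description precedes it below -/
import Mathlib

section
/- For every n ≥ 1, the number of threshold functions on n variables is at most 2^{n+1} times the number of non-negative threshold functions on n variables, i.e., |LT(n)| ≤ 2^{n+1} · |LT⁺(n)|. -/
/-- The vector `(r0, r)` realizes the Boolean function `f`:
`f x = 1` iff `r₁x₁ + ⋯ + rₙxₙ ≥ r₀`. -/
def Realizes (n : ℕ) (r0 : ℝ) (r : Fin n → ℝ) (f : (Fin n → Bool) → Bool) : Prop :=
  ∀ x : Fin n → Bool, f x = true ↔ r0 ≤ ∑ i : Fin n, (if x i then r i else 0)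

/-- `f` is a (linear) threshold function on `n` variables. -/
def IsLT (n : ℕ) (f : (Fin n → Bool) → Bool) : Prop :=
  ∃ r0 : ℝ, ∃ r : Fin n → ℝ, Realizes n r0 r f

/-- `f` is a non-negative threshold function on `n` variables: it is realizable
by some vector all of whose entries are non-negative. -/
def IsLTpos (n : ℕ) (f : (Fin n → Bool) → Bool) : Prop :=
  ∃ r0 : ℝ, ∃ r : Fin n → ℝ, 0 ≤ r0 ∧ (∀ i, 0 ≤ r i) ∧ Realizes n r0 r f

theorem lt_flip (n : ℕ) (f : (Fin n → Bool) → Bool) (hf : IsLT n f) :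
    ∃ p : (Fin n → Bool) × {g : (Fin n → Bool) → Bool // IsLTpos n g},
      ∀ x, f x = p.2.1 (fun i => xor (x i) (p.1 i)) := by
  obtain ⟨r0, r, h⟩ := hf
  let s : Fin n → Bool := fun i => decide (r i < 0)
  refine ⟨(s, ⟨fun y => f (fun i => xor (y i) (s i)),
    max 0 (r0 - ∑ i, (if s i then r i else 0)), fun i => |r i|,
    le_max_left _ _, fun i => abs_nonneg _, ?_⟩), ?_⟩
  · intro y
    have key : ∑ i, (if xor (y i) (s i) then r i else 0) =
        ∑ i, (if s i then r i else 0) + ∑ i, (if y i then |r i| else 0) := by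
      rw [← Finset.sum_add_distrib]
      refine Finset.sum_congr rfl fun i _ => ?_
      by_cases hr : r i < 0
      · cases hy : y i <;> simp [s, hr, abs_of_neg hr]
      · cases hy : y i <;> simp [s, hr, abs_of_nonneg (not_lt.mp hr)]
    have hS : 0 ≤ ∑ i, (if y i then |r i| else 0) :=
      Finset.sum_nonneg fun i _ => by split_ifs <;> simp
    rw [h, key, max_le_iff]
    constructor
    · intro h1
      exact ⟨hS, by linarith⟩
    · rintro ⟨_, h1⟩
      linarith
  · intro x
    simp

/-- For every `n ≥ 1`, `|LT(n)| ≤ 2^(n+1) · |LT⁺(n)|`. -/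
theorem stmt4 (n : ℕ) (hn : 1 ≤ n) :
    Nat.card {f : (Fin n → Bool) → Bool // IsLT n f} ≤
      2 ^ (n + 1) * Nat.card {f : (Fin n → Bool) → Bool // IsLTpos n f} := by
  choose F hF using fun f : {f : (Fin n → Bool) → Bool // IsLT n f} => lt_flip n f.1 f.2
  have hinj : Function.Injective F := by
    intro a b hab
    apply Subtype.ext
    funext x
    rw [hF a, hF b, hab]
  have h1 := Nat.card_le_card_of_injective F hinj
  rw [Nat.card_prod] at h1
  have h2 : Nat.card (Fin n → Bool) = 2 ^ n := by simp
  rw [h2] at h1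
  exact h1.trans (Nat.mul_le_mul_right _ (Nat.pow_le_pow_right (by norm_num) (by omega)))
end

section
/- There exists N₀ such that for all n ≥ N₀, the number of weighted voting games on n players is at least 2^{n²(1 − 10/log₂ n) − n − 1}. -/
/-- A weighted voting game on `n` players, described by its set `W` of winning
coalitions. -/
def IsWVG (n : ℕ) (W : Finset (Finset (Fin n))) : Prop :=
  ∃ q : ℝ, ∃ w : Fin n → ℝ, 0 ≤ q ∧ (∀ i, 0 ≤ w i) ∧
    ∀ S : Finset (Fin n), S ∈ W ↔ q ≤ ∑ i ∈ S, w i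


section
open Finset

/-- Rows on which the linear form takes a value in `{0,1}`. -/
noncomputable def zRow {p : ℕ} (l : Fin p → ℝ) : Finset (Finset (Fin p)) := by
  classical
  exact univ.filter (fun A => ∑ j ∈ A, l j = 0 ∨ ∑ j ∈ A, l j = 1)

lemma mem_zRow {p : ℕ} (l : Fin p → ℝ) (A : Finset (Fin p)) :
    A ∈ zRow l ↔ (∑ j ∈ A, l j = 0 ∨ ∑ j ∈ A, l j = 1) := by
  classical
  simp [zRow]

lemma sum_symmDiff_single {α : Type*} [DecidableEq α] (l : α → ℝ) (i : α) (A : Finset α) :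
    ∑ j ∈ symmDiff A {i}, l j = ∑ j ∈ A, l j + (if i ∈ A then - l i else l i) := by
  by_cases h : i ∈ A
  · have : symmDiff A {i} = A.erase i := by
      ext x; simp only [mem_symmDiff, mem_singleton, mem_erase]
      by_cases hx : x = i
      · subst hx; simp [h]
      · simp [hx]
    rw [this, if_pos h, ← Finset.add_sum_erase A l h]; ring
  · have : symmDiff A {i} = insert i A := by
      ext x; simp only [mem_symmDiff, mem_singleton, mem_insert]
      by_cases hx : x = i
      · subst hx; simp [h]
      · simp [hx]
    rw [this, if_neg h, Finset.sum_insert h]; ring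

lemma zRow_le_34 {p : ℕ} (l : Fin p → ℝ) (i j : Fin p) (hij : i ≠ j) (hi : l i ≠ 0) (hj : l j ≠ 0) :
    4 * (zRow l).card ≤ 3 * 2 ^ p := by
  classical
  set B := (zRow l)ᶜ with hB
  have hc : (zRow l).card + B.card = 2 ^ p := by
    rw [hB, Finset.card_add_card_compl]; simp
  have hcov : (univ : Finset (Finset (Fin p))) ⊆
      B ∪ B.image (fun A => symmDiff A {i}) ∪ B.image (fun A => symmDiff A {j})
        ∪ B.image (fun A => symmDiff (symmDiff A {j}) {i}) := by
    intro A _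
    by_contra hA
    simp only [mem_union, not_or] at hA
    obtain ⟨⟨⟨h1, h2⟩, h3⟩, h4⟩ := hA
    have e2 : symmDiff A {i} ∉ B := fun h => h2 (mem_image.2 ⟨_, h, by simp⟩)
    have e3 : symmDiff A {j} ∉ B := fun h => h3 (mem_image.2 ⟨_, h, by simp⟩)
    have e4 : symmDiff (symmDiff A {i}) {j} ∉ B := fun h => h4 (mem_image.2 ⟨_, h, by simp⟩)
    rw [hB, mem_compl, not_not, mem_zRow] at h1 e2 e3 e4
    rw [sum_symmDiff_single] at e4
    rw [sum_symmDiff_single] at e2 e3 e4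
    have : (j ∈ symmDiff A {i}) ↔ j ∈ A := by
      simp [mem_symmDiff, hij.symm]
    rw [if_congr this rfl rfl] at e4
    set s := ∑ j ∈ A, l j
    have hd1 : (if i ∈ A then - l i else l i) ≠ 0 := by split_ifs <;> simpa using hi
    have hd2 : (if j ∈ A then - l j else l j) ≠ 0 := by split_ifs <;> simpa using hj
    generalize (if i ∈ A then - l i else l i) = d1 at *
    generalize (if j ∈ A then - l j else l j) = d2 at *
    rcases h1 with h1 | h1 <;> rcases e2 with e2 | e2 <;> rcases e3 with e3 | e3 <;>
      rcases e4 with e4 | e4 <;> first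
        | exact hd1 (by linarith)
        | exact hd2 (by linarith)
  have h := card_le_card hcov
  have h1 := card_union_le (B ∪ B.image (fun A => symmDiff A {i}) ∪ B.image (fun A => symmDiff A {j}))
    (B.image (fun A => symmDiff (symmDiff A {j}) {i}))
  have h2 := card_union_le (B ∪ B.image (fun A => symmDiff A {i})) (B.image (fun A => symmDiff A {j}))
  have h3 := card_union_le B (B.image (fun A => symmDiff A {i}))
  have i1 := card_image_le (s := B) (f := fun A => symmDiff A {i})
  have i2 := card_image_le (s := B) (f := fun A => symmDiff A {j})
  have i3 := card_image_le (s := B) (f := fun A => symmDiff (symmDiff A {j}) {i})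
  have hu : (univ : Finset (Finset (Fin p))).card = 2 ^ p := by simp
  omega

lemma centralBinom_sq (m : ℕ) : (2 * m + 1) * (m.centralBinom) ^ 2 ≤ 16 ^ m := by
  induction m with
  | zero => simp
  | succ m ih =>
    have h := Nat.succ_mul_centralBinom_succ m
    have h2 : (m + 1) ^ 2 * ((2 * (m + 1) + 1) * (m + 1).centralBinom ^ 2)
        ≤ (m + 1) ^ 2 * 16 ^ (m + 1) := by
      calc (m + 1) ^ 2 * ((2 * (m + 1) + 1) * (m + 1).centralBinom ^ 2)
          = (2 * m + 3) * ((m + 1) * (m + 1).centralBinom) ^ 2 := by ring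
        _ = 4 * (2 * m + 3) * (2 * m + 1) * ((2 * m + 1) * m.centralBinom ^ 2) := by rw [h]; ring
        _ ≤ 4 * (2 * m + 3) * (2 * m + 1) * 16 ^ m := by gcongr
        _ ≤ 16 * (m + 1) ^ 2 * 16 ^ m := Nat.mul_le_mul_right _ (by nlinarith)
        _ = _ := by ring
    exact Nat.le_of_mul_le_mul_left h2 (by positivity)

lemma choose_half_sq (k : ℕ) : k * (k.choose (k / 2)) ^ 2 ≤ 4 ^ k := by
  rcases Nat.even_or_odd' k with ⟨m, rfl | rfl⟩
  · have := centralBinom_sq m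
    rw [Nat.centralBinom] at this
    rw [Nat.mul_div_cancel_left _ (by norm_num), pow_mul]
    calc _ ≤ (2 * m + 1) * ((2 * m).choose m) ^ 2 := by gcongr; omega
      _ ≤ _ := by simpa using this
  · have := centralBinom_sq (m + 1)
    have e : (2 * m + 1) / 2 = m := by omega
    have h2 : (m + 1).centralBinom = 2 * (2 * m + 1).choose m := by
      rw [Nat.centralBinom, show 2 * (m + 1) = (2 * m + 1) + 1 by ring, Nat.choose_succ_succ,
        Nat.choose_symm_half]; ring
    rw [e]
    rw [h2] at this
    have h4 : (4:ℕ) ^ (2 * m + 1) = 4 * 16 ^ m := by rw [pow_succ, pow_mul]; norm_num; ring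
    rw [h4]
    have h5 : (16:ℕ) ^ (m + 1) = 16 * 16 ^ m := by ring
    rw [h5] at this
    nlinarith [sq_nonneg ((2 * m + 1).choose m)]

lemma sum_symmDiff_neg {α : Type*} [DecidableEq α] (l : α → ℝ) (N A : Finset α)
    (hN : ∀ j, j ∈ N ↔ l j < 0) :
    ∑ j ∈ symmDiff A N, |l j| = ∑ j ∈ A, l j - ∑ j ∈ N, l j := by
  have h1 : symmDiff A N = (A \ N) ∪ (N \ A) := rfl
  rw [h1, sum_union (disjoint_sdiff_sdiff)]
  have a1 : ∑ j ∈ A \ N, |l j| = ∑ j ∈ A \ N, l j := sum_congr rfl fun j hj => by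
    rw [mem_sdiff, hN] at hj; exact abs_of_nonneg (not_lt.1 hj.2)
  have a2 : ∑ j ∈ N \ A, |l j| = - ∑ j ∈ N \ A, l j := by
    rw [← sum_neg_distrib]
    exact sum_congr rfl fun j hj => by
      rw [mem_sdiff, hN] at hj; exact abs_of_neg hj.1
  have b1 := sum_inter_add_sum_sdiff A N l
  have b2 := sum_inter_add_sum_sdiff N A l
  rw [inter_comm] at b2
  rw [a1, a2]
  linarith

lemma littlewood_offord {p : ℕ} (l : Fin p → ℝ) (K : Finset (Fin p)) (hK : ∀ j, l j ≠ 0 ↔ j ∈ K)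
    (a : ℝ) (F : Finset (Finset (Fin p))) (hF : ∀ A ∈ F, ∑ j ∈ A, l j = a) :
    F.card ≤ (K.card.choose (K.card / 2)) * 2 ^ (p - K.card) := by
  classical
  have himg : (F.image (fun A => A \ K)).card ≤ 2 ^ (p - K.card) := by
    have : F.image (fun A => A \ K) ⊆ (Kᶜ).powerset := by
      intro B hB
      obtain ⟨A, _, rfl⟩ := mem_image.1 hB
      rw [mem_powerset]
      intro x hx
      simp only [mem_sdiff, mem_compl] at *
      exact hx.2
    refine (card_le_card this).trans ?_
    rw [card_powerset, card_compl, Fintype.card_fin]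
  refine (card_le_mul_card_image (f := fun A => A \ K) F (K.card.choose (K.card / 2)) ?_).trans
    (Nat.mul_le_mul_left _ himg)
  intro B _
  set G := F.filter (fun A => A \ K = B) with hG
  set N := univ.filter (fun j => l j < 0) with hN
  have hN' : ∀ j, j ∈ N ↔ l j < 0 := by simp [hN]
  set g : Finset (Fin p) → Finset K := fun A => (symmDiff A N).subtype (· ∈ K) with hg
  have key : ∀ A ∈ G, ∀ A' ∈ G, g A ⊆ g A' → A = A' := by
    intro A hA A' hA' hsub
    rw [hG, mem_filter] at hA hA'
    have hNK : N ⊆ K := fun j hj => by rw [← hK]; exact ((hN' j).1 hj).ne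
    have hss : symmDiff A N ⊆ symmDiff A' N := by
      intro x hx
      by_cases hxK : x ∈ K
      · have : (⟨x, hxK⟩ : K) ∈ g A := by simp [hg, hx]
        have := hsub this
        simpa [hg] using this
      · have hxN : x ∉ N := fun h => hxK (hNK h)
        have hxA : x ∈ A := by
          rw [mem_symmDiff] at hx; tauto
        have : x ∈ A' \ K := by rw [hA'.2, ← hA.2]; simp [hxA, hxK]
        rw [mem_symmDiff]; left; exact ⟨(mem_sdiff.1 this).1, hxN⟩
    have hsum : ∑ j ∈ symmDiff A N, |l j| = ∑ j ∈ symmDiff A' N, |l j| := by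
      rw [sum_symmDiff_neg l N A hN', sum_symmDiff_neg l N A' hN', hF A hA.1, hF A' hA'.1]
    have heq : symmDiff A N = symmDiff A' N := by
      refine Subset.antisymm hss ?_
      intro x hx
      by_contra hxn
      by_cases hxK : x ∈ K
      · have : ∑ j ∈ symmDiff A N, |l j| < ∑ j ∈ symmDiff A' N, |l j| :=
          sum_lt_sum_of_subset hss hx hxn (abs_pos.2 ((hK x).2 hxK)) (fun _ _ _ => abs_nonneg _)
        exact this.ne hsum
      · have hxN : x ∉ N := fun h => hxK (hNK h)
        have hxA : x ∈ A' := by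
          rw [mem_symmDiff] at hx; tauto
        have : x ∈ A \ K := by rw [hA.2, ← hA'.2]; simp [hxA, hxK]
        exact hxn (by rw [mem_symmDiff]; left; exact ⟨(mem_sdiff.1 this).1, hxN⟩)
    exact symmDiff_left_injective N heq
  have hinj : Set.InjOn g G := fun A hA A' hA' h => key A hA A' hA' h.subset
  rw [← card_image_of_injOn hinj]
  have := IsAntichain.sperner (𝒜 := G.image g) (by
    intro X hX Y hY hne hXY
    obtain ⟨A, hA, rfl⟩ := mem_image.1 (mem_coe.1 hX)
    obtain ⟨A', hA', rfl⟩ := mem_image.1 (mem_coe.1 hY)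
    exact hne (by rw [key A hA A' hA' hXY]))
  simpa using this

lemma zRow_le_LO {p : ℕ} (l : Fin p → ℝ) (K : Finset (Fin p)) (hK : ∀ j, l j ≠ 0 ↔ j ∈ K)
    (hk : 0 < K.card) : ((zRow l).card : ℝ) ≤ 2 / √(K.card) * 2 ^ p := by
  classical
  set k := K.card with hkdef
  have hkp : k ≤ p := by simpa using card_le_univ K
  have h : (zRow l).card ≤ 2 * ((k.choose (k / 2)) * 2 ^ (p - k)) := by
    have hsub : zRow l ⊆ univ.filter (fun A => ∑ j ∈ A, l j = 0) ∪
        univ.filter (fun A => ∑ j ∈ A, l j = 1) := by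
      intro A hA; rw [mem_zRow] at hA; simpa using hA
    have h0 := littlewood_offord l K hK 0 (univ.filter (fun A => ∑ j ∈ A, l j = 0)) (by simp)
    have h1 := littlewood_offord l K hK 1 (univ.filter (fun A => ∑ j ∈ A, l j = 1)) (by simp)
    rw [← hkdef] at h0 h1
    have := (card_le_card hsub).trans (card_union_le _ _)
    omega
  have hs : 0 < √(k:ℝ) := Real.sqrt_pos.2 (by exact_mod_cast hk)
  have hc : √(k:ℝ) * (k.choose (k / 2)) ≤ 2 ^ k := by
    have := choose_half_sq k
    have h' : (k:ℝ) * (k.choose (k / 2) : ℝ) ^ 2 ≤ 4 ^ k := by exact_mod_cast this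
    apply le_of_sq_le_sq _ (by positivity)
    rw [mul_pow, Real.sq_sqrt (by positivity), ← pow_mul, mul_comm k 2, pow_mul]
    norm_num
    exact h'
  have h' : ((zRow l).card : ℝ) ≤ 2 * ((k.choose (k / 2) : ℝ) * 2 ^ (p - k)) := by exact_mod_cast h
  refine h'.trans ?_
  have e : (2:ℝ) ^ p = 2 ^ k * 2 ^ (p - k) := by rw [← pow_add]; congr 1; omega
  rw [e, div_mul_eq_mul_div, le_div_iff₀ hs]
  have : (0:ℝ) ≤ 2 ^ (p - k) := by positivity
  nlinarith [mul_le_mul_of_nonneg_right hc this]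

/-- Vectors supported on `K`, with zero sum, killed by the rows in `R`. -/
def zKer {n p : ℕ} (M : Fin n → Finset (Fin p)) (K : Finset (Fin p)) (R : Finset (Fin n)) :
    Submodule ℝ (Fin p → ℝ) where
  carrier := {m | (∀ j, j ∉ K → m j = 0) ∧ ∑ j, m j = 0 ∧ ∀ r ∈ R, ∑ j ∈ M r, m j = 0}
  add_mem' := by
    rintro a b ⟨h1, h2, h3⟩ ⟨g1, g2, g3⟩
    refine ⟨fun j hj => by simp [h1 j hj, g1 j hj], by simp [sum_add_distrib, h2, g2],
      fun r hr => by simp [sum_add_distrib, h3 r hr, g3 r hr]⟩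
  zero_mem' := by simp
  smul_mem' := by
    rintro c a ⟨h1, h2, h3⟩
    refine ⟨fun j hj => by simp [h1 j hj], by simp [← mul_sum, h2],
      fun r hr => by simp [← mul_sum, h3 r hr]⟩

lemma zKer_finrank {n p : ℕ} (M : Fin n → Finset (Fin p)) (K : Finset (Fin p))
    (R : Finset (Fin n)) : Module.finrank ℝ (zKer M K R) ≤ K.card := by
  have : Module.finrank ℝ (K → ℝ) = K.card := by simp
  rw [← this]
  let f : zKer M K R →ₗ[ℝ] (K → ℝ) :=
    (LinearMap.funLeft ℝ ℝ (fun j : K => (j : Fin p))).comp (zKer M K R).subtype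
  refine LinearMap.finrank_le_finrank_of_injective (f := f) ?_
  rw [← LinearMap.ker_eq_bot, LinearMap.ker_eq_bot']
  rintro ⟨m, hm⟩ h
  ext j
  by_cases hj : j ∈ K
  · exact congrFun h ⟨j, hj⟩
  · exact hm.1 j hj

lemma exists_rows {n p : ℕ} (M : Fin n → Finset (Fin p)) (K : Finset (Fin p)) (hkn : K.card ≤ n)
    (hu : zKer M K univ = ⊥) : ∃ R : Finset (Fin n), R.card = K.card ∧ zKer M K R = ⊥ := by
  classical
  have hanti : ∀ R R' : Finset (Fin n), R ⊆ R' → zKer M K R' ≤ zKer M K R :=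
    fun R R' h m hm => ⟨hm.1, hm.2.1, fun r hr => hm.2.2 r (h hr)⟩
  have claim : ∀ j : ℕ, ∃ R : Finset (Fin n), R.card ≤ j ∧
      (Module.finrank ℝ (zKer M K R) + j ≤ K.card ∨ zKer M K R = ⊥) := by
    intro j
    induction j with
    | zero => exact ⟨∅, by simp, Or.inl (by simpa using zKer_finrank M K ∅)⟩
    | succ j ih =>
      obtain ⟨R, hR, h⟩ := ih
      by_cases hb : zKer M K R = ⊥
      · exact ⟨R, by omega, Or.inr hb⟩
      obtain ⟨m, hm, hm0⟩ := (Submodule.ne_bot_iff _).1 hb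
      have : ∃ r, ∑ j ∈ M r, m j ≠ 0 := by
        by_contra hcon
        push Not at hcon
        have : m ∈ zKer M K univ := ⟨hm.1, hm.2.1, fun r _ => hcon r⟩
        rw [hu] at this
        exact hm0 (by simpa using this)
      obtain ⟨r, hr⟩ := this
      refine ⟨insert r R, (card_insert_le _ _).trans (by omega), Or.inl ?_⟩
      have hlt : zKer M K (insert r R) < zKer M K R := by
        refine lt_of_le_of_ne (hanti _ _ (subset_insert _ _)) ?_
        intro he
        rw [← he] at hm
        exact hr (hm.2.2 r (mem_insert_self _ _))
      have := Submodule.finrank_lt_finrank_of_lt hlt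
      rcases h with h | h
      · omega
      · exact absurd h hb
  obtain ⟨R, hR, h⟩ := claim K.card
  have hb : zKer M K R = ⊥ := by
    rcases h with h | h
    · exact Submodule.finrank_eq_zero.1 (by omega)
    · exact h
  obtain ⟨R', hRR', hc⟩ := Finset.exists_superset_card_eq hR (by simpa using hkn)
  exact ⟨R', hc, le_bot_iff.1 (hb ▸ hanti _ _ hRR')⟩

/-- Bad matrices for the column set `K`. -/
def zBad {n p : ℕ} (K : Finset (Fin p)) (M : Fin n → Finset (Fin p)) : Prop :=
  ∃ l : Fin p → ℝ, (∀ j, l j ≠ 0 ↔ j ∈ K) ∧ ∑ j, l j = 1 ∧ (∀ r, M r ∈ zRow l) ∧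
    zKer M K univ = ⊥

open Classical in
lemma zBad_card {n p : ℕ} (K : Finset (Fin p)) (hkn : K.card ≤ n) (β : ℕ)
    (hβ : ∀ l : Fin p → ℝ, (∀ j, l j ≠ 0 ↔ j ∈ K) → (zRow l).card ≤ β) :
    (univ.filter (fun M : Fin n → Finset (Fin p) => zBad K M)).card ≤
      n.choose K.card * (((2 ^ p) ^ K.card * 2 ^ K.card) * β ^ (n - K.card)) := by
  -- the coefficient vector determined by the rows in `R`
  let P : (R : Finset (Fin n)) → (R → Finset (Fin p)) × (R → Bool) → (Fin p → ℝ) → Prop :=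
    fun R D l => (∀ j, l j ≠ 0 ↔ j ∈ K) ∧ ∑ j, l j = 1 ∧
      ∀ r, ∑ j ∈ D.1 r, l j = if D.2 r then 1 else 0
  let L : (R : Finset (Fin n)) → (R → Finset (Fin p)) × (R → Bool) → (Fin p → ℝ) :=
    fun R D => if h : ∃ l, P R D l then h.choose else fun j => if j ∈ K then 1 else 0
  have hL : ∀ R D j, L R D j ≠ 0 ↔ j ∈ K := by
    intro R D j
    by_cases h : ∃ l, P R D l
    · simp only [L, dif_pos h]; exact h.choose_spec.1 j
    · simp only [L, dif_neg h]; simp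
  let C : (R : Finset (Fin n)) → (R → Finset (Fin p)) × (R → Bool) → Finset (Fin n → Finset (Fin p)) :=
    fun R D => Fintype.piFinset (fun r => if h : r ∈ R then {D.1 ⟨r, h⟩} else zRow (L R D))
  have hC : ∀ R D, R.card = K.card → (C R D).card ≤ β ^ (n - K.card) := by
    intro R D hR
    simp only [C, Fintype.card_piFinset]
    calc ∏ r, (if h : r ∈ R then {D.1 ⟨r, h⟩} else zRow (L R D)).card
        ≤ ∏ r, (if r ∈ R then 1 else β) := by
          refine prod_le_prod' fun r _ => ?_
          by_cases h : r ∈ R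
          · simp [h]
          · simp only [h, dif_neg, if_neg, not_false_eq_true]; exact hβ _ (hL R D)
      _ = β ^ (n - K.card) := by
          rw [prod_ite]
          simp only [prod_const_one, one_mul, prod_const]
          congr 1
          rw [← hR]
          have : univ.filter (fun r => r ∉ R) = Rᶜ := by ext; simp
          rw [this, card_compl, Fintype.card_fin]
  have hcov : univ.filter (fun M : Fin n → Finset (Fin p) => zBad K M) ⊆
      (powersetCard K.card univ).biUnion (fun R => univ.biUnion (fun D => C R D)) := by
    intro M hM
    obtain ⟨l, hl, hl1, hrow, hu⟩ := (mem_filter.1 hM).2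
    obtain ⟨R, hR, hb⟩ := exists_rows M K hkn hu
    rw [mem_biUnion]
    refine ⟨R, by simp [mem_powersetCard, hR], ?_⟩
    rw [mem_biUnion]
    let D : (R → Finset (Fin p)) × (R → Bool) :=
      (fun r => M r, fun r => decide (∑ j ∈ M r, l j = 1))
    refine ⟨D, mem_univ _, ?_⟩
    have hP : P R D l := by
      refine ⟨hl, hl1, fun r => ?_⟩
      rcases (mem_zRow _ _).1 (hrow r) with h | h <;> simp [D, h]
    have hex : ∃ l, P R D l := ⟨l, hP⟩
    have hLl : L R D = l := by
      have e : L R D = hex.choose := by simp only [L, dif_pos hex]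
      have hP' := hex.choose_spec
      rw [← e] at hP'
      have : L R D - l ∈ zKer M K R := by
        refine ⟨fun j hj => ?_, ?_, fun r hr => ?_⟩
        · have h1 : l j = 0 := by_contra fun h => hj ((hl j).1 h)
          have h2 : L R D j = 0 := by_contra fun h => hj ((hL R D j).1 h)
          simp [h1, h2]
        · simp [sum_sub_distrib, hl1, hP'.2.1]
        · have h1 := hP.2.2 ⟨r, hr⟩
          have h2 := hP'.2.2 ⟨r, hr⟩
          rw [← h1] at h2
          simp only [D] at h2
          simp only [Pi.sub_apply, sum_sub_distrib, sub_eq_zero]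
          exact h2
      rw [hb] at this
      exact sub_eq_zero.1 (by simpa using this)
    simp only [C, Fintype.mem_piFinset]
    intro r
    by_cases h : r ∈ R
    · simp [h, D]
    · simp only [h, dif_neg, not_false_eq_true]; rw [hLl]; exact hrow r
  refine (card_le_card hcov).trans (card_biUnion_le.trans ?_)
  calc _ ≤ ∑ R ∈ powersetCard K.card (univ : Finset (Fin n)),
        (((2 ^ p) ^ K.card * 2 ^ K.card) * β ^ (n - K.card)) := by
        refine sum_le_sum fun R hR => ?_
        have hR' : R.card = K.card := (mem_powersetCard.1 hR).2
        refine card_biUnion_le.trans ((sum_le_sum fun D _ => hC R D hR').trans ?_)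
        rw [sum_const, smul_eq_mul]
        refine le_of_eq ?_
        congr 1
        rw [card_univ, Fintype.card_prod, Fintype.card_fun, Fintype.card_fun]
        simp [hR']
    _ = _ := by simp

open Classical in
lemma zAll_card {n p : ℕ} (l : Fin p → ℝ) :
    (univ.filter (fun M : Fin n → Finset (Fin p) => ∀ r, M r ∈ zRow l)).card =
      (zRow l).card ^ n := by
  have : univ.filter (fun M : Fin n → Finset (Fin p) => ∀ r, M r ∈ zRow l) =
      Fintype.piFinset (fun _ => zRow l) := by ext; simp [Fintype.mem_piFinset]
  rw [this]; simp

/-- The extended incidence vector of a coalition. -/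
def zVec {n : ℕ} (S : Finset (Fin n)) : Option (Fin n) → ℝ
  | none => 1
  | some i => if i ∈ S then 1 else 0

/-- Columns of a matrix. -/
def zCol {n p : ℕ} (M : Fin n → Finset (Fin p)) (j : Fin p) : Finset (Fin n) :=
  univ.filter (fun r => j ∈ M r)

/-- Good matrices. -/
def zGood {n p : ℕ} (M : Fin n → Finset (Fin p)) : Prop :=
  (∀ K : Finset (Fin p), 2 ≤ K.card → ¬ zBad K M) ∧
  (∀ i j : Fin p, i ≠ j → ¬ ∀ r, M r ∈ zRow (Pi.single i 1 - Pi.single j 1))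

lemma sum_zsingle {p : ℕ} (i : Fin p) (A : Finset (Fin p)) :
    ∑ x ∈ A, (Pi.single i 1 : Fin p → ℝ) x = if i ∈ A then 1 else 0 := by
  simp [Pi.single_apply]

lemma zGood_inj {n p : ℕ} {M : Fin n → Finset (Fin p)} (h : zGood M) :
    Function.Injective (zCol M) := by
  intro i j hij
  by_contra hne
  refine h.2 i j hne fun r => ?_
  rw [mem_zRow]
  left
  have : i ∈ M r ↔ j ∈ M r := by
    have := congrArg (fun s => r ∈ s) hij
    simpa [zCol] using this
  simp only [Pi.sub_apply, sum_sub_distrib, sum_zsingle, this, sub_self]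

lemma zGood_closed {n p : ℕ} {M : Fin n → Finset (Fin p)} (h : zGood M) (S : Finset (Fin n))
    (l : Fin p → ℝ) (hl : ∑ j, l j = 1) (hS : ∀ r, ∑ j ∈ M r, l j = if r ∈ S then 1 else 0) :
    ∃ j, l j ≠ 0 ∧ S = zCol M j := by
  classical
  let Q : ℕ → Prop := fun k => ∃ K : Finset (Fin p), K.card = k ∧ (∀ j ∈ K, l j ≠ 0) ∧
    ∃ m : Fin p → ℝ, (∀ j, j ∉ K → m j = 0) ∧ ∑ j, m j = 1 ∧
      ∀ r, ∑ j ∈ M r, m j = if r ∈ S then 1 else 0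
  have hQ : ∃ k, Q k := ⟨_, univ.filter (fun j => l j ≠ 0), rfl, by simp, l, by simp, hl, hS⟩
  obtain ⟨K, hKc, hKl, m, hm0, hm1, hmS⟩ := Nat.find_spec hQ
  have hmin : ∀ K' : Finset (Fin p), K' ⊂ K → ∀ m : Fin p → ℝ, (∀ j, j ∉ K' → m j = 0) →
      ∑ j, m j = 1 → (∀ r, ∑ j ∈ M r, m j = if r ∈ S then 1 else 0) → False := by
    intro K' hK' m' h1 h2 h3
    refine Nat.find_min hQ (m := K'.card) ?_ ⟨K', rfl, fun j hj => hKl j (hK'.1 hj), m', h1, h2, h3⟩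
    rw [← hKc]; exact card_lt_card hK'
  have hne : ∀ j, m j ≠ 0 ↔ j ∈ K := by
    intro j
    constructor
    · intro hj; by_contra hjK; exact hj (hm0 j hjK)
    · intro hj h0
      refine hmin (K.erase j) (erase_ssubset hj) m (fun i hi => ?_) hm1 hmS
      by_cases hij : i = j
      · rw [hij, h0]
      · exact hm0 i fun hiK => hi (mem_erase.2 ⟨hij, hiK⟩)
  have hker : zKer M K univ = ⊥ := by
    by_contra hb
    obtain ⟨c, hc, hc0⟩ := (Submodule.ne_bot_iff _).1 hb
    obtain ⟨j, hj⟩ := Function.ne_iff.1 hc0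
    have hjK : j ∈ K := by by_contra hjK; exact hj (hc.1 j hjK)
    refine hmin (K.erase j) (erase_ssubset hjK) (m - (m j / c j) • c) (fun i hi => ?_) ?_ ?_
    · by_cases hij : i = j
      · subst hij
        have : c i ≠ 0 := hj
        simp; field_simp; simp
      · have hiK : i ∉ K := fun hiK => hi (mem_erase.2 ⟨hij, hiK⟩)
        simp [hm0 i hiK, hc.1 i hiK]
    · simp [sum_sub_distrib, ← mul_sum, hc.2.1, hm1]
    · intro r
      simp only [Pi.sub_apply, Pi.smul_apply, smul_eq_mul, sum_sub_distrib, ← mul_sum,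
        hc.2.2 r (mem_univ r), hmS r, mul_zero, sub_zero]
  have hk2 : K.card < 2 := by
    by_contra hk
    refine h.1 K (not_lt.1 hk) ⟨m, hne, hm1, fun r => ?_, hker⟩
    rw [mem_zRow, hmS r]
    split_ifs <;> simp
  have hk0 : K.card ≠ 0 := by
    intro h0
    rw [card_eq_zero] at h0
    have : ∑ j, m j = 0 := sum_eq_zero fun j _ => hm0 j (by simp [h0])
    rw [hm1] at this
    exact one_ne_zero this
  obtain ⟨j, hj⟩ := card_eq_one.1 (show K.card = 1 by omega)
  have hmj : m = Pi.single j (m j) := by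
    ext i
    by_cases hij : i = j
    · subst hij; simp
    · rw [hm0 i (by simp [hj, hij])]; simp [hij]
  have hm1' : m j = 1 := by
    rw [hmj] at hm1; simpa using hm1
  rw [hm1'] at hmj
  refine ⟨j, hKl j (by simp [hj]), ?_⟩
  ext r
  have := hmS r
  rw [hmj, sum_zsingle] at this
  simp only [zCol, mem_filter, mem_univ, true_and]
  by_cases h1 : r ∈ S <;> by_cases h2 : j ∈ M r <;> simp_all

lemma sum_zVec {n p : ℕ} (M : Fin n → Finset (Fin p)) (c : Fin p → ℝ) (o : Option (Fin n)) :
    (∑ j, c j • zVec (zCol M j)) o = o.elim (∑ j, c j) (fun r => ∑ j ∈ M r, c j) := by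
  cases o with
  | none => simp [zVec]
  | some r => simp [zVec, zCol]

lemma zGood_indep {n p : ℕ} {M : Fin n → Finset (Fin p)} (h : zGood M) :
    LinearIndependent ℝ (fun j => zVec (zCol M j)) := by
  classical
  rw [Fintype.linearIndependent_iff]
  intro c hc i
  by_contra hi
  have h0 : ∑ j, c j = 0 := by
    have := congrFun hc none
    rw [sum_zVec] at this; simpa using this
  have hr : ∀ r, ∑ j ∈ M r, c j = 0 := fun r => by
    have := congrFun hc (some r)
    rw [sum_zVec] at this; simpa using this
  obtain ⟨j, hj, hij⟩ := zGood_closed h (zCol M i) (Pi.single i 1 - (1 / c i) • c)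
    (by simp [sum_sub_distrib, ← mul_sum, h0])
    (fun r => by
      simp only [Pi.sub_apply, Pi.smul_apply, smul_eq_mul, sum_sub_distrib, ← mul_sum, hr r,
        mul_zero, sub_zero, sum_zsingle, zCol, mem_filter, mem_univ, true_and])
  have := zGood_inj h hij
  subst this
  apply hj
  simp [hi]

lemma zGood_span {n p : ℕ} {M : Fin n → Finset (Fin p)} (h : zGood M) (S : Finset (Fin n))
    (hS : zVec S ∈ Submodule.span ℝ (Set.range (fun j => zVec (zCol M j)))) :
    ∃ j, S = zCol M j := by
  obtain ⟨c, hc⟩ := (Submodule.mem_span_range_iff_exists_fun ℝ).1 hS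
  obtain ⟨j, _, hj⟩ := zGood_closed h S c
    (by have := congrFun hc none; rw [sum_zVec] at this; simpa [zVec] using this)
    (fun r => by have := congrFun hc (some r); rw [sum_zVec] at this; simpa [zVec] using this)
  exact ⟨j, hj⟩

/-- Threshold functions (arbitrary real weights). -/
def zThr {n : ℕ} (A : Finset (Finset (Fin n))) : Prop :=
  ∃ f : (Option (Fin n) → ℝ) →ₗ[ℝ] ℝ, ∀ S, S ∈ A ↔ 0 ≤ f (zVec S)

lemma exists_functional {p : ℕ} {E : Type*} [AddCommGroup E] [Module ℝ E] (v : Fin p → E)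
    (hv : LinearIndependent ℝ v) (c : Fin p → ℝ) : ∃ f : E →ₗ[ℝ] ℝ, ∀ j, f (v j) = c j := by
  classical
  have hker : LinearMap.ker (Fintype.linearCombination ℝ v) = ⊥ := by
    rw [LinearMap.ker_eq_bot]
    exact linearIndependent_iff_injective_fintypeLinearCombination.1 hv
  obtain ⟨Ψ, hΨ⟩ := LinearMap.exists_leftInverse_of_injective _ hker
  refine ⟨(Fintype.linearCombination ℝ c).comp Ψ, fun j => ?_⟩
  have h1 : Ψ (v j) = Pi.single j 1 := by
    have := LinearMap.congr_fun hΨ (Pi.single j 1)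
    simpa [Fintype.linearCombination_apply_single] using this
  simp [h1]

lemma strong_shatter {n p : ℕ} (T : Fin p → Finset (Fin n))
    (hLI : LinearIndependent ℝ (fun j => zVec (T j)))
    (hcl : ∀ S, zVec S ∈ Submodule.span ℝ (Set.range (fun j => zVec (T j))) → ∃ j, S = T j) :
    ∃ t : Finset (Finset (Fin n)), (∀ j, T j ∉ t) ∧
      ∀ A : Finset (Finset (Fin n)), (∀ S, (∀ j, S ≠ T j) → (S ∈ A ↔ S ∈ t)) → zThr A := by
  classical
  set W := Submodule.span ℝ (Set.range (fun j => zVec (T j))) with hW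
  obtain ⟨f, hf⟩ := Module.exists_dual_forall_apply_ne_zero (K := ℝ)
    (fun S : {S : Finset (Fin n) // ∀ j, S ≠ T j} => W.mkQ (zVec S.1)) (by
      intro S h0
      rw [Submodule.mkQ_apply, Submodule.Quotient.mk_eq_zero] at h0
      obtain ⟨j, hj⟩ := hcl _ h0
      exact S.2 j hj)
  set g : (Option (Fin n) → ℝ) →ₗ[ℝ] ℝ := f.comp W.mkQ with hg
  have hg0 : ∀ j, g (zVec (T j)) = 0 := by
    intro j
    have : W.mkQ (zVec (T j)) = 0 := by
      rw [Submodule.mkQ_apply, Submodule.Quotient.mk_eq_zero]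
      exact Submodule.subset_span ⟨j, rfl⟩
    rw [hg, LinearMap.comp_apply, this, map_zero]
  have hg1 : ∀ S, (∀ j, S ≠ T j) → g (zVec S) ≠ 0 := fun S hS => hf ⟨S, hS⟩
  refine ⟨univ.filter (fun S => 0 < g (zVec S)), fun j => by simp [hg0], fun A hA => ?_⟩
  obtain ⟨h, hh⟩ := exists_functional _ hLI (fun j => if T j ∈ A then 1 else -1)
  have hev : ∀ᶠ ε in nhdsWithin (0:ℝ) (Set.Ioi 0),
      ∀ S : Finset (Fin n), S ∈ A ↔ 0 ≤ g (zVec S) + ε * h (zVec S) := by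
    rw [Filter.eventually_all]
    intro S
    by_cases hS : ∀ j, S ≠ T j
    · have hcont : Filter.Tendsto (fun ε : ℝ => g (zVec S) + ε * h (zVec S))
          (nhdsWithin (0:ℝ) (Set.Ioi 0)) (nhds (g (zVec S))) := by
        have : Continuous (fun ε : ℝ => g (zVec S) + ε * h (zVec S)) := by fun_prop
        have := this.tendsto 0
        simp only [zero_mul, add_zero] at this
        exact this.mono_left nhdsWithin_le_nhds
      rw [hA S hS]
      rcases lt_or_gt_of_ne (hg1 S hS) with hlt | hgt
      · filter_upwards [hcont.eventually (gt_mem_nhds hlt)] with ε hε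
        simp only [mem_filter, mem_univ, true_and]
        constructor
        · intro; linarith
        · intro; linarith
      · filter_upwards [hcont.eventually (lt_mem_nhds hgt)] with ε hε
        simp only [mem_filter, mem_univ, true_and]
        exact ⟨fun _ => hε.le, fun _ => hgt⟩
    · push Not at hS
      obtain ⟨j, rfl⟩ := hS
      filter_upwards [self_mem_nhdsWithin] with ε hε
      have hε' : 0 < ε := hε
      rw [hg0, hh]
      by_cases hj : T j ∈ A
      · simp [hj, hε'.le]
      · simp [hj, hε']
  obtain ⟨ε, hε⟩ := hev.exists
  exact ⟨g + ε • h, fun S => by simpa using hε S⟩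

open Classical in
lemma card_strong_le {n : ℕ} (G : Finset (Finset (Finset (Fin n))))
    (hG : ∀ I ∈ G, ∃ t : Finset (Finset (Fin n)), Disjoint I t ∧
      ∀ A : Finset (Finset (Fin n)), (∀ S, S ∉ I → (S ∈ A ↔ S ∈ t)) → zThr A) :
    G.card ≤ (univ.filter (fun A : Finset (Finset (Fin n)) => zThr A)).card := by
  set F := univ.filter (fun A : Finset (Finset (Fin n)) => zThr A) with hF
  have h1 : G.image compl ⊆ (Fᶜ.shatterer)ᶜ := by
    intro J hJ
    obtain ⟨I, hI, rfl⟩ := mem_image.1 hJ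
    rw [mem_compl, mem_shatterer]
    intro hs
    obtain ⟨t, hd, ht⟩ := hG I hI
    have hts : t ⊆ Iᶜ := fun x hx => mem_compl.2 fun hxI => disjoint_left.1 hd hxI hx
    obtain ⟨A, hA, hAt⟩ := hs hts
    rw [mem_compl, hF] at hA
    apply hA
    simp only [mem_filter, mem_univ, true_and]
    refine ht A fun S hS => ?_
    rw [← hAt]
    simp [hS]
  have h2 := card_le_card h1
  rw [card_image_of_injective _ compl_injective, card_compl] at h2
  have h3 := card_le_card_shatterer Fᶜ
  have h4 : F.card + Fᶜ.card = _ := card_add_card_compl F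
  omega

open Classical in
lemma zThr_le_WVG (n : ℕ) :
    (univ.filter (fun A : Finset (Finset (Fin n)) => zThr A)).card ≤
      2 ^ n * Nat.card {W : Finset (Finset (Fin n)) // IsWVG n W} := by
  rw [Nat.card_eq_fintype_card, Fintype.card_subtype]
  set V := univ.filter (fun W : Finset (Finset (Fin n)) => IsWVG n W) with hV
  have hcov : univ.filter (fun A : Finset (Finset (Fin n)) => zThr A) ⊆
      (univ : Finset (Finset (Fin n))).biUnion
        (fun s => V.image (fun W => univ.filter (fun S => symmDiff S s ∈ W))) := by
    intro A hA
    obtain ⟨f, hf⟩ := (mem_filter.1 hA).2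
    let w : Fin n → ℝ := fun i => f (Pi.single (some i) 1)
    let c : ℝ := f (Pi.single none 1)
    have hfS : ∀ S, f (zVec S) = c + ∑ i ∈ S, w i := by
      intro S
      have : zVec S = Pi.single none 1 + ∑ i ∈ S, Pi.single (some i) (1:ℝ) := by
        ext o
        cases o with
        | none => simp [zVec]
        | some i => simp [zVec, Pi.single_apply]
      rw [this, map_add, map_sum]
    let s : Finset (Fin n) := univ.filter (fun i => w i < 0)
    have hs : ∀ i, i ∈ s ↔ w i < 0 := by simp [s]
    rw [mem_biUnion]
    refine ⟨s, mem_univ _, mem_image.2 ⟨univ.filter (fun S => symmDiff S s ∈ A), ?_, ?_⟩⟩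
    · rw [hV, mem_filter]
      refine ⟨mem_univ _, max 0 (-c - ∑ i ∈ s, w i), fun i => |w i|, le_max_left _ _,
        fun i => abs_nonneg _, fun S => ?_⟩
      have e := sum_symmDiff_neg w s (symmDiff S s) hs
      rw [symmDiff_symmDiff_cancel_right] at e
      have hpos : 0 ≤ ∑ i ∈ S, |w i| := sum_nonneg fun i _ => abs_nonneg _
      simp only [mem_filter, mem_univ, true_and, hf, hfS, max_le_iff, hpos]
      constructor <;> intro <;> linarith
    · ext S; simp
  refine (card_le_card hcov).trans (card_biUnion_le.trans ?_)
  refine (sum_le_sum fun s _ => card_image_le).trans ?_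
  simp

open Classical in
lemma zGood_card_le (n p : ℕ) :
    (univ.filter (fun M : Fin n → Finset (Fin p) => zGood M)).card ≤
      p ^ p * (2 ^ n * Nat.card {W : Finset (Finset (Fin n)) // IsWVG n W}) := by
  set Gd := univ.filter (fun M : Fin n → Finset (Fin p) => zGood M) with hGd
  refine (card_le_mul_card_image (f := fun M => univ.image (zCol M)) Gd (p ^ p) ?_).trans
    (Nat.mul_le_mul_left _ ((card_strong_le _ ?_).trans (zThr_le_WVG n)))
  · intro I hI
    obtain ⟨M0, hM0, rfl⟩ := mem_image.1 hI
    have hinj0 : Function.Injective (zCol (n := n) (p := p)) := by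
      intro M M' h
      ext r j
      have := congrArg (fun F => r ∈ F j) h
      simpa [zCol] using this
    rw [← card_image_of_injective _ hinj0]
    have hsub : image zCol (Gd.filter (fun M => univ.image (zCol M) = univ.image (zCol M0))) ⊆
        Fintype.piFinset (fun _ : Fin p => univ.image (zCol M0)) := by
      intro T hT
      obtain ⟨M, hM, rfl⟩ := mem_image.1 hT
      rw [Fintype.mem_piFinset]
      intro j
      rw [← (mem_filter.1 hM).2]
      exact mem_image_of_mem _ (mem_univ _)
    refine (card_le_card hsub).trans ?_
    rw [Fintype.card_piFinset_const]
    gcongr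
    exact card_image_le.trans (by simp)
  · intro I hI
    obtain ⟨M, hM, rfl⟩ := mem_image.1 hI
    have hg : zGood M := (mem_filter.1 hM).2
    obtain ⟨t, ht1, ht2⟩ := strong_shatter (zCol M) (zGood_indep hg) (zGood_span hg)
    refine ⟨t, ?_, fun A hA => ht2 A fun S hS => hA S ?_⟩
    · rw [disjoint_left]
      intro S hS
      obtain ⟨j, _, rfl⟩ := mem_image.1 hS
      exact ht1 j
    · simp only [mem_image, mem_univ, true_and, not_exists]
      exact fun j hj => hS j hj.symm

/-- Probability bound for one row. -/
noncomputable def zB (k : ℕ) : ℝ := min (3 / 4) (2 / √(k : ℝ))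

lemma zB_nonneg (k : ℕ) : 0 ≤ zB k := by unfold zB; positivity

lemma zRow_le {p : ℕ} (l : Fin p → ℝ) (K : Finset (Fin p)) (hK : ∀ j, l j ≠ 0 ↔ j ∈ K)
    (hk : 2 ≤ K.card) : ((zRow l).card : ℝ) ≤ zB K.card * 2 ^ p := by
  have h2 := zRow_le_LO l K hK (by omega)
  obtain ⟨i, hi, j, hj, hij⟩ := one_lt_card.1 (show 1 < K.card by omega)
  have h1 := zRow_le_34 l i j hij ((hK i).2 hi) ((hK j).2 hj)
  have h1' : 4 * ((zRow l).card : ℝ) ≤ 3 * 2 ^ p := by exact_mod_cast h1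
  unfold zB
  rcases min_choice (3 / 4 : ℝ) (2 / √(K.card : ℝ)) with h | h <;> rw [h]
  · linarith
  · exact h2

open Classical in
lemma zBad_card' {n p : ℕ} (K : Finset (Fin p)) (hpn : p ≤ n) (hk : 2 ≤ K.card) :
    ((univ.filter (fun M : Fin n → Finset (Fin p) => zBad K M)).card : ℝ) ≤
      2 ^ (n * p) * (n.choose K.card * 2 ^ K.card * zB K.card ^ (n - K.card)) := by
  have hkp : K.card ≤ p := by simpa using card_le_univ K
  have hnn : 0 ≤ zB K.card * 2 ^ p := mul_nonneg (zB_nonneg _) (by positivity)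
  have h := zBad_card (n := n) K (by omega) ⌊zB K.card * 2 ^ p⌋₊
    (fun l hl => Nat.le_floor (zRow_le l K hl hk))
  have h' : ((univ.filter (fun M : Fin n → Finset (Fin p) => zBad K M)).card : ℝ) ≤
      n.choose K.card * (((2 ^ p) ^ K.card * 2 ^ K.card) *
        (⌊zB K.card * 2 ^ p⌋₊ : ℝ) ^ (n - K.card)) := by exact_mod_cast h
  refine h'.trans ?_
  have hfl : (⌊zB K.card * 2 ^ p⌋₊ : ℝ) ≤ zB K.card * 2 ^ p := Nat.floor_le hnn
  calc _ ≤ (n.choose K.card : ℝ) * (((2 ^ p) ^ K.card * 2 ^ K.card) *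
        (zB K.card * 2 ^ p) ^ (n - K.card)) := by gcongr
    _ = ((2 ^ p) ^ K.card * (2 ^ p) ^ (n - K.card)) *
        (n.choose K.card * 2 ^ K.card * zB K.card ^ (n - K.card)) := by rw [mul_pow]; ring
    _ = _ := by
      rw [← pow_add, show K.card + (n - K.card) = n by omega, ← pow_mul, mul_comm p n]

open Classical in
lemma zGood_card {n p : ℕ} (hpn : p + 1 ≤ n)
    (hk : ∀ k, 2 ≤ k → k ≤ p → (p.choose k : ℝ) * (n.choose k * 2 ^ k * zB k ^ (n - k)) ≤ 1 / (4 * n))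
    (h34 : (p : ℝ) ^ 2 * (3 / 4) ^ n ≤ 1 / 4) :
    (2 : ℝ) ^ (n * p) / 2 ≤ ((univ.filter (fun M : Fin n → Finset (Fin p) => zGood M)).card : ℝ) := by
  set Gd := univ.filter (fun M : Fin n → Finset (Fin p) => zGood M)
  let BK : Finset (Fin p) → Finset (Fin n → Finset (Fin p)) := fun K =>
    if 2 ≤ K.card then univ.filter (fun M => zBad K M) else ∅
  let BI : Fin p × Fin p → Finset (Fin n → Finset (Fin p)) := fun x =>
    if x.1 ≠ x.2 then univ.filter (fun M => ∀ r, M r ∈ zRow (Pi.single x.1 1 - Pi.single x.2 1)) else ∅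
  have hcov : (univ : Finset (Fin n → Finset (Fin p))) ⊆
      Gd ∪ ((univ : Finset (Fin p)).powerset.biUnion BK ∪ univ.biUnion BI) := by
    intro M _
    by_cases hM : zGood M
    · exact mem_union_left _ (by simp [Gd, hM])
    · apply mem_union_right
      unfold zGood at hM
      rw [not_and_or] at hM
      rcases hM with hM | hM
      · push Not at hM
        obtain ⟨K, hK, hb⟩ := hM
        apply mem_union_left
        rw [mem_biUnion]
        exact ⟨K, by simp, by simp [BK, hK, hb]⟩
      · push Not at hM
        obtain ⟨i, j, hij, hb⟩ := hM
        apply mem_union_right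
        rw [mem_biUnion]
        exact ⟨(i, j), by simp, by simp only [BI]; rw [if_pos hij]; simpa using hb⟩
  have hcard := ((card_le_card hcov).trans (card_union_le _ _)).trans
    (Nat.add_le_add_left (card_union_le _ _) _)
  have hcu : (univ : Finset (Fin n → Finset (Fin p))).card = 2 ^ (n * p) := by
    simp [← pow_mul, mul_comm]
  rw [hcu] at hcard
  have hcard' : (2:ℝ) ^ (n * p) ≤ Gd.card + (((univ : Finset (Fin p)).powerset.biUnion BK).card +
    (univ.biUnion BI).card) := by exact_mod_cast hcard
  have hn : (0:ℝ) < n := by exact_mod_cast (by omega : 0 < n)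
  have h1 : (((univ : Finset (Fin p)).powerset.biUnion BK).card : ℝ) ≤ 2 ^ (n * p) / 4 := by
    let g : ℕ → ℝ := fun k => if 2 ≤ k then
      2 ^ (n * p) * (n.choose k * 2 ^ k * zB k ^ (n - k)) else 0
    calc (((univ : Finset (Fin p)).powerset.biUnion BK).card : ℝ)
        ≤ ∑ K ∈ (univ : Finset (Fin p)).powerset, ((BK K).card : ℝ) := by
          exact_mod_cast card_biUnion_le
      _ ≤ ∑ K ∈ (univ : Finset (Fin p)).powerset, g K.card := by
          refine sum_le_sum fun K _ => ?_
          by_cases h : 2 ≤ K.card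
          · simp only [BK, g, if_pos h]
            exact zBad_card' K (by omega) h
          · simp [BK, g, if_neg h]
      _ = ∑ k ∈ range (p + 1), p.choose k • g k := by
          rw [sum_powerset_apply_card]; simp
      _ ≤ ∑ k ∈ range (p + 1), (2 ^ (n * p) * (1 / (4 * n)) : ℝ) := by
          refine sum_le_sum fun k hkr => ?_
          by_cases h : 2 ≤ k
          · simp only [g, if_pos h, nsmul_eq_mul]
            have := hk k h (by rw [mem_range] at hkr; omega)
            calc _ = 2 ^ (n * p) * ((p.choose k : ℝ) * (n.choose k * 2 ^ k * zB k ^ (n - k))) := by ring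
              _ ≤ _ := by gcongr
          · simp only [g, if_neg h, smul_zero]; positivity
      _ = (p + 1 : ℕ) * (2 ^ (n * p) * (1 / (4 * n)) : ℝ) := by simp
      _ ≤ (n : ℝ) * (2 ^ (n * p) * (1 / (4 * n)) : ℝ) := by gcongr
      _ = _ := by field_simp
  have h2 : ((univ.biUnion BI).card : ℝ) ≤ 2 ^ (n * p) / 4 := by
    calc ((univ.biUnion BI).card : ℝ) ≤ ∑ x, ((BI x).card : ℝ) := by exact_mod_cast card_biUnion_le
      _ ≤ ∑ x : Fin p × Fin p, ((3 / 4 * 2 ^ p) ^ n : ℝ) := by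
          refine sum_le_sum fun x _ => ?_
          by_cases h : x.1 ≠ x.2
          · simp only [BI, if_pos h]
            rw [zAll_card]
            push_cast
            gcongr
            have := zRow_le_34 (Pi.single x.1 1 - Pi.single x.2 1) x.1 x.2 h
              (by simp [h]) (by simp [h.symm])
            have h1' : 4 * ((zRow (Pi.single x.1 1 - Pi.single x.2 1 : Fin p → ℝ)).card : ℝ)
              ≤ 3 * 2 ^ p := by exact_mod_cast this
            linarith
          · simp only [BI, if_neg h, card_empty, Nat.cast_zero]; positivity
      _ = ((p:ℝ) ^ 2 * (3 / 4) ^ n) * 2 ^ (n * p) := by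
          simp [mul_pow, ← pow_mul, mul_comm p n]; ring
      _ ≤ 1 / 4 * 2 ^ (n * p) := by gcongr
      _ = _ := by ring
  linarith

lemma term_bound {n p k : ℕ} {x L y : ℝ} (hx : x = n) (hL : 10 ≤ L) (hxL : (2:ℝ) ^ L = x)
    (hy1 : 120 * L ≤ y) (hy5 : y ^ 5 = x) (hp : (p : ℝ) ≤ x - 9 * x / L)
    (hk2 : 2 ≤ k) (hkp : k ≤ p) :
    (p.choose k : ℝ) * (n.choose k * 2 ^ k * zB k ^ (n - k)) ≤ 1 / (4 * n) := by
  have hy : 1200 ≤ y := by linarith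
  have hx0 : 0 < x := by rw [← hy5]; positivity
  have hL0 : 0 < L := by linarith
  have hpx : (p : ℝ) ≤ x := hp.trans (by have : 0 ≤ 9 * x / L := by positivity
                                         linarith)
  have hpn : p ≤ n := by rw [hx] at hpx; exact_mod_cast hpx
  have hkx : (k : ℝ) ≤ p := by exact_mod_cast hkp
  have hnk : ((n - k : ℕ) : ℝ) = x - k := by rw [Nat.cast_sub (by omega), hx]
  have hk0 : (0:ℝ) < k := by exact_mod_cast (by omega : 0 < k)
  have hyx : y ≤ x := by
    rw [← hy5]; exact le_self_pow₀ (by linarith) (by norm_num)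
  have hrhs : 1 / (4 * (n:ℝ)) = (2:ℝ) ^ (-2 - L) := by
    rw [Real.rpow_sub (by norm_num), hxL, ← hx, Real.rpow_neg (by norm_num)]
    norm_num
    field_simp
  rw [hrhs]
  have h2pos : (0:ℝ) < 2 := by norm_num
  by_cases hc : 4 * y ^ 4 ≤ k
  · -- large support
    have hs : 2 * y ^ 2 ≤ √(k:ℝ) := by
      apply Real.le_sqrt_of_sq_le
      nlinarith
    have hyL : y = 2 ^ (L / 5) := by
      have : (y ^ 5) = ((2:ℝ) ^ (L / 5)) ^ 5 := by
        rw [hy5, ← Real.rpow_natCast, ← Real.rpow_mul h2pos.le, ← hxL]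
        congr 1; push_cast; ring
      exact (pow_left_inj₀ (by linarith) (by positivity) (by norm_num)).1 this
    have hB : zB k ≤ (2:ℝ) ^ (-(2 * L / 5)) := by
      calc zB k ≤ 2 / √(k:ℝ) := min_le_right _ _
        _ ≤ 2 / (2 * y ^ 2) := by gcongr
        _ = (y ^ 2)⁻¹ := by field_simp
        _ = _ := by
          rw [hyL, ← Real.rpow_natCast, ← Real.rpow_mul h2pos.le, ← Real.rpow_neg h2pos.le]
          congr 1; push_cast; ring
    have hBp : zB k ^ (n - k) ≤ (2:ℝ) ^ (-(3.6 * x)) := by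
      calc zB k ^ (n - k) ≤ ((2:ℝ) ^ (-(2 * L / 5))) ^ (n - k) := by
            gcongr; exact zB_nonneg k
        _ = (2:ℝ) ^ (-(2 * L / 5) * (x - k)) := by
            rw [← Real.rpow_natCast, ← Real.rpow_mul h2pos.le, hnk]
        _ ≤ _ := by
            apply Real.rpow_le_rpow_of_exponent_le (by norm_num)
            have h1 : 9 * x / L ≤ x - k := by linarith
            have h2 : 9 * x ≤ (x - k) * L := (div_le_iff₀ hL0).1 h1
            nlinarith
    have hc1 : (p.choose k : ℝ) ≤ 2 ^ x := by
      have h1 : (p.choose k : ℝ) ≤ 2 ^ p := by exact_mod_cast Nat.choose_le_two_pow p k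
      refine h1.trans ?_
      rw [← Real.rpow_natCast]
      exact Real.rpow_le_rpow_of_exponent_le (by norm_num) hpx
    have hc2 : (n.choose k : ℝ) ≤ 2 ^ x := by
      have h1 : (n.choose k : ℝ) ≤ 2 ^ n := by exact_mod_cast Nat.choose_le_two_pow n k
      refine h1.trans ?_
      rw [← Real.rpow_natCast, hx]
    have hc3 : (2:ℝ) ^ k ≤ 2 ^ x := by
      rw [← Real.rpow_natCast]
      exact Real.rpow_le_rpow_of_exponent_le (by norm_num) (hkx.trans hpx)
    have hz := pow_nonneg (zB_nonneg k) (n - k)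
    calc (p.choose k : ℝ) * (n.choose k * 2 ^ k * zB k ^ (n - k))
        ≤ 2 ^ x * (2 ^ x * 2 ^ x * (2:ℝ) ^ (-(3.6 * x))) := by gcongr
      _ = (2:ℝ) ^ (x + (x + x + -(3.6 * x))) := by
          rw [Real.rpow_add h2pos, Real.rpow_add h2pos, Real.rpow_add h2pos]
      _ ≤ _ := by
          apply Real.rpow_le_rpow_of_exponent_le (by norm_num)
          linarith
  · push Not at hc
    have hy4 : y ^ 4 * 1200 ≤ x := by
      rw [← hy5]; have : 0 ≤ y ^ 4 := by positivity
      nlinarith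
    have hkhalf : (k:ℝ) ≤ x / 2 := by linarith
    have hkL : (k:ℝ) * (2 * L + 1) ≤ 0.1 * x := by
      have h1 : (k:ℝ) * (2 * L + 1) ≤ 4 * y ^ 4 * (3 * L) := by
        gcongr
        linarith
      have h2 : y ^ 4 * (120 * L) ≤ y ^ 4 * y := by gcongr
      have h3 : y ^ 4 * y = x := by rw [← hy5]; ring
      linarith
    have h34 : (3/4 : ℝ) ≤ 2 ^ (-(0.4:ℝ)) := by
      have : (3/4 : ℝ) ^ 5 ≤ ((2:ℝ) ^ (-(0.4:ℝ))) ^ 5 := by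
        rw [← Real.rpow_natCast (2 ^ (-(0.4:ℝ))), ← Real.rpow_mul h2pos.le]
        norm_num
      exact (pow_le_pow_iff_left₀ (by norm_num) (by positivity) (by norm_num)).1 this
    have hBp : zB k ^ (n - k) ≤ (2:ℝ) ^ (-(0.2 * x)) := by
      calc zB k ^ (n - k) ≤ ((2:ℝ) ^ (-(0.4:ℝ))) ^ (n - k) := by
            gcongr
            · exact zB_nonneg k
            · exact (min_le_left _ _).trans h34
        _ = (2:ℝ) ^ (-(0.4:ℝ) * (x - k)) := by
            rw [← Real.rpow_natCast, ← Real.rpow_mul h2pos.le, hnk]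
        _ ≤ _ := by
            apply Real.rpow_le_rpow_of_exponent_le (by norm_num)
            linarith
    have hxk : x ^ k = (2:ℝ) ^ (L * k) := by
      rw [Real.rpow_mul h2pos.le, hxL, Real.rpow_natCast]
    have hc1 : (p.choose k : ℝ) ≤ 2 ^ (L * k) := by
      have h1 : (p.choose k : ℝ) ≤ (p:ℝ) ^ k := by exact_mod_cast Nat.choose_le_pow p k
      rw [← hxk]
      exact h1.trans (by gcongr)
    have hc2 : (n.choose k : ℝ) ≤ 2 ^ (L * k) := by
      have h1 : (n.choose k : ℝ) ≤ (n:ℝ) ^ k := by exact_mod_cast Nat.choose_le_pow n k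
      rw [← hxk, hx]
      exact h1
    have hz := pow_nonneg (zB_nonneg k) (n - k)
    calc (p.choose k : ℝ) * (n.choose k * 2 ^ k * zB k ^ (n - k))
        ≤ 2 ^ (L * k) * (2 ^ (L * k) * 2 ^ k * (2:ℝ) ^ (-(0.2 * x))) := by gcongr
      _ = (2:ℝ) ^ (L * k + (L * k + k + -(0.2 * x))) := by
          rw [Real.rpow_add h2pos, Real.rpow_add h2pos, Real.rpow_add h2pos, Real.rpow_natCast]
      _ ≤ _ := by
          apply Real.rpow_le_rpow_of_exponent_le (by norm_num)
          linarith

lemma main_bound {n : ℕ} {x L y : ℝ} (hx : x = n) (hL : 10 ≤ L) (hxL : (2:ℝ) ^ L = x)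
    (hy1 : 120 * L ≤ y) (hy5 : y ^ 5 = x) :
    (2 : ℝ) ^ (x ^ 2 * (1 - 10 / L) - x - 1) ≤
      (Nat.card {W : Finset (Finset (Fin n)) // IsWVG n W} : ℝ) := by
  classical
  have h2pos : (0:ℝ) < 2 := by norm_num
  have hy : 1200 ≤ y := by linarith
  have hx0 : 0 < x := by rw [← hy5]; positivity
  have hL0 : 0 < L := by linarith
  have hyx2 : y ^ 2 ≤ x := by
    rw [← hy5]; exact pow_le_pow_right₀ (by linarith) (by norm_num)
  have hyx : y ≤ x := by nlinarith
  have hLx : 120 * L ≤ x := by linarith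
  set p := ⌊x - 9 * x / L⌋₊ with hpdef
  have hnn : 0 ≤ x - 9 * x / L := by
    rw [sub_nonneg, div_le_iff₀ hL0]; nlinarith
  have hp : (p:ℝ) ≤ x - 9 * x / L := Nat.floor_le hnn
  have hp' : x - 9 * x / L < p + 1 := Nat.lt_floor_add_one _
  have h9 : 1 ≤ 9 * x / L := by rw [le_div_iff₀ hL0]; linarith
  have hpn : p + 1 ≤ n := by
    have : (p:ℝ) + 1 ≤ n := by rw [← hx]; linarith
    exact_mod_cast this
  have hpx : (p:ℝ) ≤ x := by linarith
  have h34 : (p : ℝ) ^ 2 * (3 / 4) ^ n ≤ 1 / 4 := by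
    have h34' : (3/4 : ℝ) ≤ 2 ^ (-(0.4:ℝ)) := by
      have : (3/4 : ℝ) ^ 5 ≤ ((2:ℝ) ^ (-(0.4:ℝ))) ^ 5 := by
        rw [← Real.rpow_natCast (2 ^ (-(0.4:ℝ))), ← Real.rpow_mul h2pos.le]
        norm_num
      exact (pow_le_pow_iff_left₀ (by norm_num) (by positivity) (by norm_num)).1 this
    calc (p : ℝ) ^ 2 * (3 / 4) ^ n ≤ x ^ 2 * (2 ^ (-(0.4:ℝ))) ^ n := by gcongr
      _ = (2:ℝ) ^ (L * 2 + (-(0.4:ℝ) * x)) := by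
        rw [Real.rpow_add h2pos, Real.rpow_mul h2pos.le, hxL, Real.rpow_mul h2pos.le, hx,
          Real.rpow_natCast]
        norm_num
      _ ≤ (2:ℝ) ^ (-2 : ℝ) := by
        apply Real.rpow_le_rpow_of_exponent_le (by norm_num)
        linarith
      _ = 1 / 4 := by rw [Real.rpow_neg h2pos.le]; norm_num
  have hgood := zGood_card hpn
    (fun k hk2 hkp => term_bound hx hL hxL hy1 hy5 hp hk2 hkp) h34
  have hle := zGood_card_le n p
  set C := Nat.card {W : Finset (Finset (Fin n)) // IsWVG n W}
  have hle' : ((univ.filter (fun M : Fin n → Finset (Fin p) => zGood M)).card : ℝ) ≤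
      (p:ℝ) ^ p * (2 ^ n * C) := by exact_mod_cast hle
  have h := hgood.trans hle'
  have hpp : (p:ℝ) ^ p ≤ 2 ^ (L * x) := by
    calc (p:ℝ) ^ p ≤ x ^ p := by gcongr
      _ ≤ x ^ n := pow_le_pow_right₀ (by linarith) (by omega)
      _ = _ := by rw [Real.rpow_mul h2pos.le, hxL, ← Real.rpow_natCast, hx]
  have hC0 : (0:ℝ) ≤ C := Nat.cast_nonneg _
  have h3 : (2:ℝ) ^ (x * p - 1) ≤ 2 ^ (L * x + x) * C := by
    calc (2:ℝ) ^ (x * p - 1) = 2 ^ (n * p) / 2 := by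
          rw [Real.rpow_sub h2pos, Real.rpow_one, hx, ← Nat.cast_mul, Real.rpow_natCast]
      _ ≤ (p:ℝ) ^ p * (2 ^ n * C) := h
      _ ≤ 2 ^ (L * x) * (2 ^ n * C) := by gcongr
      _ = _ := by
        rw [Real.rpow_add h2pos]
        nth_rw 3 [hx]
        rw [Real.rpow_natCast]; ring
  have h4 : (2:ℝ) ^ (x * p - 1 - (L * x + x)) ≤ C := by
    rw [Real.rpow_sub h2pos, div_le_iff₀ (by positivity), mul_comm (C:ℝ)]
    exact h3
  refine le_trans ?_ h4
  apply Real.rpow_le_rpow_of_exponent_le (by norm_num)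
  have e1 : x * (x - 9 * x / L - 1) ≤ x * p := by gcongr; linarith
  have e2 : L + L ^ 2 ≤ x := by nlinarith
  have e3 : x * (L + 1) ≤ x ^ 2 / L := by
    rw [le_div_iff₀ hL0]; nlinarith
  have e4 : x ^ 2 * (1 - 10 / L) = x ^ 2 - 10 * (x ^ 2 / L) := by ring
  have e5 : x * (x - 9 * x / L - 1) = x ^ 2 - 9 * (x ^ 2 / L) - x := by ring
  nlinarith

lemma eventually_params : ∃ N₀ : ℕ, ∀ n : ℕ, N₀ ≤ n →
    1 ≤ n ∧ 10 ≤ Real.logb 2 n ∧ 120 * Real.logb 2 n ≤ (n:ℝ) ^ (1 / 5 : ℝ) := by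
  have hlog2 : 0 < Real.log 2 := Real.log_pos (by norm_num)
  have h1 := (isLittleO_log_rpow_atTop (show (0:ℝ) < 1 / 5 by norm_num)).bound
    (show 0 < Real.log 2 / 120 by positivity)
  have h2 : ∀ᶠ x : ℝ in Filter.atTop, 120 * Real.logb 2 x ≤ x ^ (1 / 5 : ℝ) := by
    filter_upwards [h1, Filter.eventually_ge_atTop 1] with x hx hx1
    rw [Real.norm_eq_abs, Real.norm_eq_abs, abs_of_nonneg (Real.log_nonneg hx1),
      abs_of_nonneg (by positivity)] at hx
    rw [Real.logb]
    calc 120 * (Real.log x / Real.log 2) ≤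
        120 * ((Real.log 2 / 120 * x ^ (1 / 5 : ℝ)) / Real.log 2) := by gcongr
      _ = _ := by field_simp
  have h3 : ∀ᶠ x : ℝ in Filter.atTop, 10 ≤ Real.logb 2 x :=
    (Real.tendsto_logb_atTop (by norm_num)).eventually_ge_atTop 10
  have h4 := tendsto_natCast_atTop_atTop.eventually (h2.and h3)
  obtain ⟨N, hN⟩ := Filter.eventually_atTop.1 (h4.and (Filter.eventually_ge_atTop 1))
  exact ⟨N, fun n hn => ⟨(hN n hn).2, (hN n hn).1.2, (hN n hn).1.1⟩⟩

end

/-- For all large enough `n`, the number of weighted voting games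
on `n` players is at least `2 ^ (n²(1 − 10/log₂ n) − n − 1)`. -/
theorem stmt5 : ∃ N₀ : ℕ, ∀ n : ℕ, N₀ ≤ n →
    (2 : ℝ) ^ ((n : ℝ) ^ 2 * (1 - 10 / Real.logb 2 n) - n - 1) ≤
      (Nat.card {W : Finset (Finset (Fin n)) // IsWVG n W} : ℝ) := by
  obtain ⟨N, hN⟩ := eventually_params
  refine ⟨N, fun n hn => ?_⟩
  obtain ⟨h1, h2, h3⟩ := hN n hn
  have hn0 : (0:ℝ) < n := by exact_mod_cast h1
  refine main_bound (x := n) (L := Real.logb 2 n) (y := (n:ℝ) ^ (1 / 5 : ℝ)) rfl h2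
    (Real.rpow_logb (by norm_num) (by norm_num) hn0) h3 ?_
  rw [← Real.rpow_natCast, ← Real.rpow_mul hn0.le]
  norm_num
end

section
/- Let C be a ceiling of the i-bit roof game G_{i-bit} (on n = 4i players) that has at least two distinct direct left-shifts. Let p ∈ C be any player such that (C \ {p}) ∪ {p−1} is a direct left-shift of C, and let a be the index such that p is the a-th smallest-numbered player of C. Then p = 2a. -/
/-- `S'` is a direct left-shift of `S`: some player `p ∈ S` with `p ≥ 2` and
`p − 1 ∉ S` is replaced by `p − 1`. -/
def DLS (S S' : Finset ℕ) : Prop :=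
  ∃ p ∈ S, 2 ≤ p ∧ p - 1 ∉ S ∧ S' = insert (p - 1) (S.erase p)

/-- `S'` is a left-shift of `S` (a possibly empty sequence of direct
left-shifts). -/
def LeftShift : Finset ℕ → Finset ℕ → Prop :=
  Relation.ReflTransGen DLS

/-- The `(k,i)`-encoding coalition `S_{k,i}` on players `{1,…,4i}`. -/
def enc (i k : ℕ) : Finset ℕ :=
  (Finset.Icc 1 i).biUnion fun j =>
    if Nat.testBit k (j - 1) then {4 * (j - 1) + 1, 4 * (j - 1) + 4}
    else {4 * (j - 1) + 2, 4 * (j - 1) + 3}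

/-- The `i`-bit roof game `G_{i-bit}` on `n = 4i` players: a coalition is winning
iff it is a superset of a left-shift of `S_{k,i}` for some `k < 2^i`. -/
def GBit (i : ℕ) (C : Finset ℕ) : Prop :=
  ∃ k < 2 ^ i, ∃ T : Finset ℕ, LeftShift (enc i k) T ∧ T ⊆ C

/-- `S` is a maximal losing coalition of the game `v` on players `{1,…,n}`. -/
def IsMaxLosing (n : ℕ) (v : Finset ℕ → Prop) (S : Finset ℕ) : Prop :=
  S ⊆ Finset.Icc 1 n ∧ ¬ v S ∧ ∀ j ∈ Finset.Icc 1 n, j ∉ S → v (insert j S)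

/-- `S` is a ceiling of `v`: a maximal losing coalition all of whose left-shifts
other than itself are winning. -/
def IsCeiling (n : ℕ) (v : Finset ℕ → Prop) (S : Finset ℕ) : Prop :=
  IsMaxLosing n v S ∧ ∀ S', LeftShift S S' → S' ≠ S → v S'

set_option autoImplicit false

/-- The `x`-th smallest-numbered player of `C` (1-indexed). -/
def nthN (C : Finset ℕ) (x : ℕ) : ℕ :=
  (C.sort (· ≤ ·)).getD (x - 1) 0

/-- number of elements of `S` below `m` -/
def cnt (S : Finset ℕ) (m : ℕ) : ℕ := Nat.count (· ∈ S) m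

lemma cnt_zero (S : Finset ℕ) : cnt S 0 = 0 := by simp [cnt]

lemma cnt_succ (S : Finset ℕ) (m : ℕ) :
    cnt S (m + 1) = cnt S m + if m ∈ S then 1 else 0 := by
  simp [cnt, Nat.count_succ]

lemma cnt_shift (S : Finset ℕ) (y : ℕ) (h1 : y ∉ S) (h2 : y + 1 ∈ S) (m : ℕ) :
    cnt (insert y (S.erase (y + 1))) m = cnt S m + if m = y + 1 then 1 else 0 := by
  induction m with
  | zero => simp [cnt_zero]
  | succ m ih =>
    rw [cnt_succ, cnt_succ, ih]
    by_cases a : m = y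
    · subst a; simp [h1]
    · by_cases b : m = y + 1
      · subst b; simp [h2]
      · simp [a, b]

lemma cnt_mono (S T : Finset ℕ) (h : S ⊆ T) (m : ℕ) : cnt S m ≤ cnt T m :=
  Nat.count_mono_left (fun _ _ hk => h hk)

lemma dls_cnt {S T : Finset ℕ} (h : DLS S T) : ∀ m, cnt S m ≤ cnt T m := by
  obtain ⟨p, hp, h2, hn, rfl⟩ := h
  obtain ⟨y, rfl⟩ : ∃ y, p = y + 1 := ⟨p - 1, by omega⟩
  intro m
  simp only [Nat.add_sub_cancel] at *
  rw [cnt_shift S y hn hp]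
  omega

lemma ls_cnt {S T : Finset ℕ} (h : LeftShift S T) : ∀ m, cnt S m ≤ cnt T m := by
  induction h with
  | refl => intro m; exact le_rfl
  | tail _ h ih => intro m; exact (ih m).trans (dls_cnt h m)

lemma exists_ls (C : Finset ℕ) (hC : 0 ∉ C) : ∀ (N : ℕ) (S : Finset ℕ), ∑ x ∈ S, x = N → 0 ∉ S →
    (∀ m, cnt S m ≤ cnt C m) → ∃ T, LeftShift S T ∧ T ⊆ C := by
  intro N
  induction N using Nat.strong_induction_on with
  | _ N ih =>
  intro S hN hS hm
  by_cases hsub : S ⊆ C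
  · exact ⟨S, Relation.ReflTransGen.refl, hsub⟩
  obtain ⟨x, hx, hxC⟩ := Finset.not_subset.1 hsub
  -- walk down from `x`
  have key : ∀ d, d ≤ x → (∃ y, y ∉ S ∧ y + 1 ∈ S ∧ cnt S (y + 1) + 1 ≤ cnt C (y + 1)) ∨
      (x - d ∈ S ∧ cnt S (x - d) + 1 ≤ cnt C (x - d)) := by
    intro d
    induction d with
    | zero =>
      intro _
      right
      have := hm (x + 1)
      rw [cnt_succ, cnt_succ] at this
      simp [hx, hxC] at this
      exact ⟨hx, this⟩
    | succ d ihd =>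
      intro hd
      rcases ihd (by omega) with h | ⟨h1, h2⟩
      · exact Or.inl h
      · obtain ⟨y, hy⟩ : ∃ y, x - d = y + 1 := ⟨x - d - 1, by omega⟩
        have hy' : x - (d + 1) = y := by omega
        rw [hy] at h1 h2
        rw [hy']
        by_cases hyS : y ∈ S
        · right
          refine ⟨hyS, ?_⟩
          rw [cnt_succ, cnt_succ] at h2
          simp only [hyS, if_true] at h2
          split_ifs at h2 <;> omega
        · exact Or.inl ⟨y, hyS, h1, h2⟩
  have := key x le_rfl
  simp only [Nat.sub_self, hS, false_and, or_false] at this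
  obtain ⟨y, hy, hy1, hyc⟩ := this
  have hy0 : y ≠ 0 := by
    rintro rfl
    rw [cnt_succ, cnt_succ, cnt_zero, cnt_zero] at hyc
    simp [hC] at hyc
  have hsum : ∑ x ∈ insert y (S.erase (y + 1)), x < N := by
    rw [Finset.sum_insert (by simp [hy])]
    have := Finset.add_sum_erase S (fun x => x) hy1
    omega
  obtain ⟨T, hT, hTC⟩ := ih _ hsum (insert y (S.erase (y + 1))) rfl
    (by simp [hS]; exact fun h => hy0 h.symm) (by
      intro m
      rw [cnt_shift S y hy hy1]
      split_ifs with h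
      · subst h; exact hyc
      · exact hm m)
  exact ⟨T, Relation.ReflTransGen.head ⟨y + 1, hy1, by omega, by simpa using hy, by simp⟩ hT, hTC⟩

lemma mem_enc (i k x : ℕ) : x ∈ enc i k ↔ ∃ j < i,
    if Nat.testBit k j then (x = 4 * j + 1 ∨ x = 4 * j + 4) else (x = 4 * j + 2 ∨ x = 4 * j + 3) := by
  simp only [enc, Finset.mem_biUnion, Finset.mem_Icc]
  constructor
  · rintro ⟨j, hj, h⟩
    refine ⟨j - 1, by omega, ?_⟩
    split_ifs at h ⊢ <;> simpa using h
  · rintro ⟨j, hj, h⟩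
    refine ⟨j + 1, by omega, ?_⟩
    simp only [Nat.add_sub_cancel]
    split_ifs at h ⊢ <;> simpa using h

lemma mem_enc_block (i k j r : ℕ) (hr : 1 ≤ r) (hr4 : r ≤ 4) : 4 * j + r ∈ enc i k ↔ j < i ∧
    if Nat.testBit k j then (r = 1 ∨ r = 4) else (r = 2 ∨ r = 3) := by
  rw [mem_enc]
  constructor
  · rintro ⟨l, hl, h⟩
    have : l = j := by split_ifs at h <;> omega
    subst this
    refine ⟨hl, ?_⟩
    split_ifs at h ⊢ <;> omega
  · rintro ⟨hl, h⟩
    refine ⟨j, hl, ?_⟩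
    split_ifs at h ⊢ <;> omega

lemma cnt_enc_block (i k j : ℕ) (hj : j < i) :
    cnt (enc i k) (4 * j + 2) = cnt (enc i k) (4 * j + 1) + (if Nat.testBit k j then 1 else 0) ∧
    cnt (enc i k) (4 * j + 3) = cnt (enc i k) (4 * j + 1) + 1 ∧
    cnt (enc i k) (4 * j + 4) = cnt (enc i k) (4 * j + 1) + (if Nat.testBit k j then 1 else 2) ∧
    cnt (enc i k) (4 * j + 5) = cnt (enc i k) (4 * j + 1) + 2 := by
  have e1 : cnt (enc i k) (4 * j + 2) = _ := cnt_succ (enc i k) (4 * j + 1)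
  have e2 : cnt (enc i k) (4 * j + 3) = _ := cnt_succ (enc i k) (4 * j + 2)
  have e3 : cnt (enc i k) (4 * j + 4) = _ := cnt_succ (enc i k) (4 * j + 3)
  have e4 : cnt (enc i k) (4 * j + 5) = _ := cnt_succ (enc i k) (4 * j + 4)
  have m1 := mem_enc_block i k j 1 (by omega) (by omega)
  have m2 := mem_enc_block i k j 2 (by omega) (by omega)
  have m3 := mem_enc_block i k j 3 (by omega) (by omega)
  have m4 := mem_enc_block i k j 4 (by omega) (by omega)
  cases h : Nat.testBit k j
  · simp [hj, h] at m1 m2 m3 m4 ⊢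
    rw [if_neg m1] at e1
    rw [if_pos m2] at e2
    rw [if_pos m3] at e3
    rw [if_neg m4] at e4
    omega
  · simp [hj, h] at m1 m2 m3 m4 ⊢
    rw [if_pos m1] at e1
    rw [if_neg m2] at e2
    rw [if_neg m3] at e3
    rw [if_pos m4] at e4
    omega

lemma zero_notMem_enc (i k : ℕ) : 0 ∉ enc i k := by
  rw [mem_enc]
  rintro ⟨j, hj, h⟩
  split_ifs at h <;> rcases h with h | h <;> omega

lemma cnt_enc_start (i k j : ℕ) (hj : j ≤ i) : cnt (enc i k) (4 * j + 1) = 2 * j := by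
  induction j with
  | zero => simp [cnt_succ, cnt_zero, zero_notMem_enc]
  | succ j ih =>
    have := (cnt_enc_block i k j (by omega)).2.2.2
    rw [ih (by omega)] at this
    rw [show 4 * (j + 1) + 1 = 4 * j + 5 by ring, this]; ring

lemma cnt_enc_end (i k d : ℕ) : cnt (enc i k) (4 * i + 1 + d) = 2 * i := by
  induction d with
  | zero => exact cnt_enc_start i k i le_rfl
  | succ d ih =>
    rw [← add_assoc, cnt_succ, ih, if_neg, add_zero]
    · rw [mem_enc]
      rintro ⟨j, hj, h⟩
      split_ifs at h <;> omega

/-- counting condition for winning -/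
def Win (i : ℕ) (C : Finset ℕ) : Prop :=
  (∀ t ≤ 2 * i, t ≤ cnt C (2 * t + 1)) ∧
  ∀ j < i, 2 * j + 1 ≤ cnt C (4 * j + 2) ∨ 2 * j + 2 ≤ cnt C (4 * j + 4)

lemma win_of_gbit {i : ℕ} {C : Finset ℕ} (h : GBit i C) : Win i C := by
  obtain ⟨k, _, T, hT, hTC⟩ := h
  have hm : ∀ m, cnt (enc i k) m ≤ cnt C m := fun m => (ls_cnt hT m).trans (cnt_mono _ _ hTC m)
  constructor
  · intro t ht
    have h := hm (2 * t + 1)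
    rcases Nat.even_or_odd' t with ⟨j, rfl | rfl⟩
    · have := cnt_enc_start i k j (by omega)
      rw [show 2 * (2 * j) + 1 = 4 * j + 1 by ring] at *
      omega
    · have h1 := cnt_enc_start i k j (by omega)
      have h2 := (cnt_enc_block i k j (by omega)).2.1
      rw [show 2 * (2 * j + 1) + 1 = 4 * j + 3 by ring] at *
      omega
  · intro j hj
    have h0 := cnt_enc_start i k j (by omega)
    obtain ⟨h1, -, h3, -⟩ := cnt_enc_block i k j hj
    have a1 := hm (4 * j + 2)
    have a2 := hm (4 * j + 4)
    split_ifs at h1 h3 <;> omega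

lemma gbit_of_win {i : ℕ} {C : Finset ℕ} (h0 : 0 ∉ C) (h : Win i C) : GBit i C := by
  classical
  obtain ⟨h1, h2⟩ := h
  let f : Fin i → Bool := fun j => decide (2 * (j : ℕ) + 1 ≤ cnt C (4 * j + 2))
  refine ⟨Nat.ofBits f, Nat.ofBits_lt_two_pow f, ?_⟩
  refine exists_ls C h0 _ _ rfl (zero_notMem_enc _ _) ?_
  have hf : ∀ j (hj : j < i), Nat.testBit (Nat.ofBits f) j = f ⟨j, hj⟩ := fun j hj =>
    Nat.testBit_ofBits_lt f j hj
  generalize Nat.ofBits f = k at *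
  intro m
  by_cases hmi : 4 * i + 1 ≤ m
  · obtain ⟨d, rfl⟩ := Nat.exists_eq_add_of_le hmi
    rw [cnt_enc_end]
    have := h1 (2 * i) le_rfl
    rw [show 2 * (2 * i) + 1 = 4 * i + 1 by ring] at this
    exact this.trans (Nat.count_monotone _ (by omega))
  · rcases Nat.eq_zero_or_pos m with rfl | hpos
    · simp [cnt_zero]
    obtain ⟨j, r, hr, rfl⟩ : ∃ j r, r < 4 ∧ m = 4 * j + (r + 1) :=
      ⟨(m - 1) / 4, (m - 1) % 4, by omega, by omega⟩
    have hj : j < i := by omega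
    have e0 := cnt_enc_start i k j (by omega)
    obtain ⟨e1, e2, e3, -⟩ := cnt_enc_block i k j hj
    have b0 := h1 (2 * j) (by omega)
    have b2 := h1 (2 * j + 1) (by omega)
    rw [show 2 * (2 * j) + 1 = 4 * j + 1 by ring] at b0
    rw [show 2 * (2 * j + 1) + 1 = 4 * j + 3 by ring] at b2
    have b3 := h2 j hj
    have m1 : cnt C (4 * j + 1) ≤ cnt C (4 * j + 2) := Nat.count_monotone _ (by omega)
    have m3 : cnt C (4 * j + 3) ≤ cnt C (4 * j + 4) := Nat.count_monotone _ (by omega)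
    rw [hf j hj] at e1 e3
    simp only [f, decide_eq_true_eq] at e1 e3
    interval_cases r <;> simp only [Nat.zero_add, Nat.reduceAdd] <;> split_ifs at e1 e3 <;> omega

lemma cnt_nthN (C : Finset ℕ) (a : ℕ) (ha1 : 1 ≤ a) (ha2 : a ≤ C.card) :
    cnt C (nthN C a) = a - 1 := by
  have hf : {x | x ∈ C}.Finite := C.finite_toSet
  have hfe : hf.toFinset = C := by ext; simp
  have : nthN C a = Nat.nth (· ∈ C) (a - 1) := by
    rw [Nat.nth_eq_getD_sort hf, hfe]; rfl
  rw [this, cnt]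
  apply Nat.count_nth
  intro h
  rw [hfe]; omega

theorem stmt8 (i : ℕ) (hi : 1 ≤ i) (C : Finset ℕ)
    (hC : IsCeiling (4 * i) (GBit i) C)
    (htwo : ∃ S₁ S₂ : Finset ℕ, DLS C S₁ ∧ DLS C S₂ ∧ S₁ ≠ S₂)
    (p : ℕ) (hp : p ∈ C) (hls : DLS C (insert (p - 1) (C.erase p)))
    (a : ℕ) (ha1 : 1 ≤ a) (ha2 : a ≤ C.card) (hpa : nthN C a = p) :
    p = 2 * a := by
  obtain ⟨⟨hsub, hlose, -⟩, hshift⟩ := hC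
  have h0 : 0 ∉ C := fun h => by have := hsub h; simp at this
  have hcp : cnt C p = a - 1 := by rw [← hpa]; exact cnt_nthN C a ha1 ha2
  -- a direct left-shift changes exactly one prefix count, and wins
  have hdls : ∀ q ∈ C, 2 ≤ q → q - 1 ∉ C → Win i (insert (q - 1) (C.erase q)) ∧
      ∀ m, cnt (insert (q - 1) (C.erase q)) m = cnt C m + if m = q then 1 else 0 := by
    intro q hq hq2 hq1
    refine ⟨win_of_gbit (hshift _ (Relation.ReflTransGen.single ⟨q, hq, hq2, hq1, rfl⟩) ?_), ?_⟩
    · intro h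
      apply hq1
      rw [← h]; simp
    · obtain ⟨y, rfl⟩ : ∃ y, q = y + 1 := ⟨q - 1, by omega⟩
      exact cnt_shift C y hq1 hq
  have hp1 : 2 ≤ p ∧ p - 1 ∉ C := by
    have hp0 : p ≠ 0 := fun h => h0 (h ▸ hp)
    obtain ⟨q, hq, hq2, hqn, he⟩ := hls
    have hqp : q = p := by
      by_contra hne
      have : q ∈ insert (q - 1) (C.erase q) := by
        rw [← he]; simp [hq, hne]
      simp at this
      omega
    subst hqp
    exact ⟨hq2, hqn⟩
  obtain ⟨q, hq, hq2, hq1, hqp⟩ : ∃ q ∈ C, 2 ≤ q ∧ q - 1 ∉ C ∧ q ≠ p := by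
    obtain ⟨S₁, S₂, ⟨q, hq, hq2, hq1, rfl⟩, ⟨r, hr, hr2, hr1, rfl⟩, hne⟩ := htwo
    by_cases h : q = p
    · refine ⟨r, hr, hr2, hr1, ?_⟩
      rintro rfl
      subst h
      exact hne rfl
    · exact ⟨q, hq, hq2, hq1, h⟩
  obtain ⟨⟨wp1, wp2⟩, cp⟩ := hdls p hp hp1.1 hp1.2
  obtain ⟨⟨wq1, wq2⟩, cq⟩ := hdls q hq hq2 hq1
  have hnw : ¬ Win i C := fun h => hlose (gbit_of_win h0 h)
  have ht : ∀ t ≤ 2 * i, t ≤ cnt C (2 * t + 1) := by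
    intro t ht
    have A := wp1 t ht
    have B := wq1 t ht
    rw [cp] at A
    rw [cq] at B
    split_ifs at A B <;> omega
  have hj : ¬ ∀ j < i, 2 * j + 1 ≤ cnt C (4 * j + 2) ∨ 2 * j + 2 ≤ cnt C (4 * j + 4) :=
    fun h => hnw ⟨ht, h⟩
  push Not at hj
  obtain ⟨j, hj, l1, l2⟩ := hj
  have A := wp2 j hj
  rw [cp, cp] at A
  rcases A with A | A
  · split_ifs at A with h
    · rw [← h] at hcp; omega
    · omega
  · split_ifs at A with h
    · rw [← h] at hcp; omega
    · omega
end

section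
/- Let G = (N = {1,…,n}, v) be a weighted voting game. Then there exists a weighted representation ℓ = [q; w_1, …, w_n] for G such that for all coalitions C, C' ⊆ N with C ≠ C' and v(C) = v(C') = 1, it holds that ∑_{i∈C} w_i ≠ ∑_{i∈C'} w_i, i.e., all winning coalitions have pairwise distinct weights under ℓ. -/
/-- `[q; w]` is a weighted representation of the simple game `v`. -/
def IsRep (n : ℕ) (v : Finset (Fin n) → Prop) (q : ℝ) (w : Fin n → ℝ) : Prop :=
  0 ≤ q ∧ (∀ i, 0 ≤ w i) ∧ ∀ S : Finset (Fin n), v S ↔ q ≤ ∑ i ∈ S, w i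

theorem binsum_inj (n : ℕ) (C D : Finset (Fin n))
    (h : ∑ i ∈ C, (2:ℝ) ^ (i : ℕ) = ∑ i ∈ D, (2:ℝ) ^ (i : ℕ)) : C = D := by
  have h2 : ∑ i ∈ C, 2 ^ (i : ℕ) = ∑ i ∈ D, 2 ^ (i : ℕ) := by exact_mod_cast h
  apply Finset.map_injective Fin.valEmbedding
  apply Finset.geomSum_injective (le_refl 2)
  simpa [Finset.sum_map] using h2

/-- Every weighted voting game has a weighted representation under
which all winning coalitions have pairwise distinct weights. -/
theorem stmt13 (n : ℕ) (v : Finset (Fin n) → Prop)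
    (h : ∃ q : ℝ, ∃ w : Fin n → ℝ, IsRep n v q w) :
    ∃ q : ℝ, ∃ w : Fin n → ℝ, IsRep n v q w ∧
      ∀ C C' : Finset (Fin n), C ≠ C' → v C → v C' →
        ∑ i ∈ C, w i ≠ ∑ i ∈ C', w i := by
  obtain ⟨q, w, hq, hw, hv⟩ := h
  let f : Finset (Fin n) → ℝ → ℝ := fun S e => ∑ i ∈ S, (w i + e * 2 ^ (i : ℕ))
  have hf : ∀ S e, f S e = ∑ i ∈ S, w i + e * ∑ i ∈ S, (2:ℝ) ^ (i : ℕ) := by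
    intro S e
    simp only [f, Finset.sum_add_distrib, Finset.mul_sum]
  have hc : ∀ S, Filter.Tendsto (f S) (nhdsWithin 0 (Set.Ioi 0)) (nhds (∑ i ∈ S, w i)) := by
    intro S
    have h1 : Continuous (f S) := by fun_prop
    have h2 := h1.tendsto 0
    rw [hf S 0, zero_mul, add_zero] at h2
    exact h2.mono_left nhdsWithin_le_nhds
  have hpos : ∀ᶠ e : ℝ in nhdsWithin 0 (Set.Ioi 0), 0 < e := self_mem_nhdsWithin
  have hA : ∀ᶠ e : ℝ in nhdsWithin 0 (Set.Ioi 0), ∀ S, ¬ v S → f S e < q := by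
    rw [Filter.eventually_all]
    intro S
    by_cases hS : v S
    · simp [hS]
    · have : ∑ i ∈ S, w i < q := by
        rw [hv S] at hS
        exact not_le.mp hS
      filter_upwards [(hc S).eventually_lt_const this] with e he _ using he
  have hB : ∀ᶠ e : ℝ in nhdsWithin 0 (Set.Ioi 0), ∀ C D, C ≠ D → f C e ≠ f D e := by
    rw [Filter.eventually_all]
    intro C
    rw [Filter.eventually_all]
    intro D
    by_cases hs : ∑ i ∈ C, w i = ∑ i ∈ D, w i
    · filter_upwards [hpos] with e he hCD heq
      rw [hf, hf, hs] at heq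
      exact hCD (binsum_inj n C D (mul_left_cancel₀ he.ne' (add_left_cancel heq)))
    · filter_upwards [((hc C).sub (hc D)).eventually_ne (sub_ne_zero.2 hs)] with e he _ using sub_ne_zero.1 he
  obtain ⟨e, he, hA, hB⟩ := (hpos.and (hA.and hB)).exists
  refine ⟨q, fun i => w i + e * 2 ^ (i : ℕ), ⟨hq, fun i => ?_, fun S => ⟨fun hS => ?_, fun hS => ?_⟩⟩,
    fun C D hCD _ _ => hB C D hCD⟩
  · have := hw i
    positivity
  · refine ((hv S).1 hS).trans (Finset.sum_le_sum fun i _ => ?_)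
    have : 0 < e * 2 ^ (i : ℕ) := by positivity
    linarith
  · by_contra hn
    exact absurd hS (not_le.mpr (hA S hn))
end

section
/- For every canonical weighted voting game G on players {1,…,n} whose set W of minimal winning coalitions is nonempty, there exist a coalition C ∈ W and a canonical weighted voting game G' on players {1,…,n} whose set of minimal winning coalitions is exactly W \ {C}. -/
/-- Player `i` is at least as desirable as player `j` in the simple game `v`. -/
def Desir {n : ℕ} (v : Finset (Fin n) → Prop) (i j : Fin n) : Prop :=
  ∀ S : Finset (Fin n), i ∉ S → j ∉ S → v (insert j S) → v (insert i S)

/-- `v` is a weighted voting game on `n` players. -/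
def IsWVGv (n : ℕ) (v : Finset (Fin n) → Prop) : Prop :=
  ∃ q : ℝ, ∃ w : Fin n → ℝ, 0 ≤ q ∧ (∀ i, 0 ≤ w i) ∧
    ∀ S : Finset (Fin n), v S ↔ q ≤ ∑ i ∈ S, w i

/-- `v` is a canonical weighted voting game: a weighted voting game in which
each smaller-numbered player is at least as desirable as each larger-numbered
one. -/
def IsCWVGv (n : ℕ) (v : Finset (Fin n) → Prop) : Prop :=
  IsWVGv n v ∧ ∀ i j : Fin n, i ≤ j → Desir v i j

/-- `S` is a minimal winning coalition of `v`. -/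
def IsMWCv (n : ℕ) (v : Finset (Fin n) → Prop) (S : Finset (Fin n)) : Prop :=
  v S ∧ ∀ p ∈ S, ¬ v (S.erase p)

open Finset in
lemma desir_of_antitone {n : ℕ} (v : Finset (Fin n) → Prop) (q : ℝ) (w : Fin n → ℝ)
    (hw : ∀ i j, i ≤ j → w j ≤ w i) (h : ∀ S : Finset (Fin n), v S ↔ q ≤ ∑ i ∈ S, w i) :
    ∀ i j : Fin n, i ≤ j → Desir v i j := by
  intro i j hij S hi hj hS
  rw [h] at hS ⊢
  rw [sum_insert hi]
  rw [sum_insert hj] at hS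
  linarith [hw i j hij]

lemma swap_aut {n : ℕ} (v : Finset (Fin n) → Prop) (i j : Fin n)
    (h1 : Desir v i j) (h2 : Desir v j i) (S : Finset (Fin n)) (hS : v S) :
    v (S.image (Equiv.swap i j)) := by
  have key : ∀ i j : Fin n, Desir v j i → i ∈ S → j ∉ S →
      v (S.image (Equiv.swap i j)) := by
    intro i j h2 hi hj
    have e : S.image (Equiv.swap i j) = insert j (S.erase i) := by
      have hij : i ≠ j := by rintro rfl; exact hj hi
      conv_lhs => rw [← Finset.insert_erase hi]
      rw [Finset.image_insert, Equiv.swap_apply_left]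
      congr 1
      have : (S.erase i).image (Equiv.swap i j) = (S.erase i).image id := by
        apply Finset.image_congr
        intro x hx
        have hx' : x ∈ S.erase i := hx
        rw [Finset.mem_erase] at hx'
        have : x ≠ j := by rintro rfl; exact hj hx'.2
        simp [Equiv.swap_apply_of_ne_of_ne hx'.1 this]
      rw [this, Finset.image_id]
    rw [e]
    apply h2
    · simp [hj]
    · simp
    · rwa [Finset.insert_erase hi]
  have triv : (i ∈ S ↔ j ∈ S) → S.image (Equiv.swap i j) = S := by
    intro hh
    apply Finset.eq_of_subset_of_card_le
    · intro x hx
      rw [Finset.mem_image] at hx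
      obtain ⟨y, hy, rfl⟩ := hx
      rw [Equiv.swap_apply_def]
      split_ifs with a b
      · exact hh.1 (a ▸ hy)
      · exact hh.2 (b ▸ hy)
      · exact hy
    · rw [Finset.card_image_of_injective _ (Equiv.injective _)]
  by_cases hi : i ∈ S <;> by_cases hj : j ∈ S
  · rwa [triv (by tauto)]
  · exact key i j h2 hi hj
  · rw [Equiv.swap_comm]; exact key j i h1 hj hi
  · rwa [triv (by tauto)]

open Finset Classical in
lemma sorted_rep {n : ℕ} (v : Finset (Fin n) → Prop) (hv : IsCWVGv n v) :
    ∃ q : ℝ, ∃ w : Fin n → ℝ, (∀ i, 0 ≤ w i) ∧ (∀ i j, i ≤ j → w j ≤ w i) ∧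
      ∀ S : Finset (Fin n), v S ↔ q ≤ ∑ i ∈ S, w i := by
  obtain ⟨⟨q, w, hq, hw, h⟩, hd⟩ := hv
  set P : Finset (Equiv.Perm (Fin n)) :=
    univ.filter (fun σ => ∀ S : Finset (Fin n), v (S.image σ) ↔ v S) with hP
  have hPm : ∀ σ, σ ∈ P ↔ ∀ S : Finset (Fin n), v (S.image σ) ↔ v S := by
    intro σ; simp [hP]
  have h1 : P.Nonempty := ⟨1, by rw [hPm]; intro S; simp⟩
  have hrep : ∀ S : Finset (Fin n), v S ↔ ∑ σ ∈ P, q ≤ ∑ i ∈ S, ∑ σ ∈ P, w (σ i) := by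
    intro S
    rw [sum_comm]
    have e : ∀ σ ∈ P, ∑ i ∈ S, w (σ i) = ∑ i ∈ S.image σ, w i := by
      intro σ _
      rw [sum_image (fun a _ b _ hab => σ.injective hab)]
    constructor
    · intro hS
      apply sum_le_sum
      intro σ hσ
      rw [e σ hσ, ← h, (hPm σ).1 hσ]
      exact hS
    · intro hle
      by_contra hS
      refine absurd hle (not_le.2 ?_)
      apply sum_lt_sum_of_nonempty h1
      intro σ hσ
      rw [e σ hσ]
      apply lt_of_not_ge
      intro hc
      exact hS (((hPm σ).1 hσ S).1 ((h _).2 hc))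
  refine ⟨∑ σ ∈ P, q, fun i => ∑ σ ∈ P, w (σ i), ?_, ?_, hrep⟩
  · intro i; exact sum_nonneg (fun σ _ => hw _)
  · intro i j hij
    by_cases hji : Desir v j i
    · have hs : ∀ S : Finset (Fin n), v (S.image (Equiv.swap i j)) ↔ v S := by
        intro S
        refine ⟨fun hS => ?_, swap_aut v i j (hd i j hij) hji S⟩
        have := swap_aut v i j (hd i j hij) hji _ hS
        rw [image_image] at this
        have e : ((Equiv.swap i j : Fin n → Fin n) ∘ (Equiv.swap i j)) = id := by
          ext x; simp
        rwa [e, image_id] at this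
      have hmul : ∀ σ ∈ P, σ * Equiv.swap i j ∈ P := by
        intro σ hσ
        rw [hPm] at hσ ⊢
        intro S
        rw [Equiv.Perm.coe_mul, ← image_image, hσ, hs]
      apply le_of_eq
      apply sum_bij' (fun σ _ => σ * Equiv.swap i j) (fun σ _ => σ * Equiv.swap i j) hmul hmul
      · intro σ _; simp [mul_assoc]
      · intro σ _; simp [mul_assoc]
      · intro σ _; simp
    · unfold Desir at hji
      push Not at hji
      obtain ⟨S, hj, hi, hvi, hvj⟩ := hji
      rw [hrep, sum_insert hi] at hvi
      rw [hrep, sum_insert hj] at hvj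
      linarith

open Finset in
lemma code_inj {n : ℕ} (S T : Finset (Fin n))
    (h : ∑ i ∈ S, (2:ℝ)^(Fin.rev i : ℕ) = ∑ i ∈ T, (2:ℝ)^(Fin.rev i : ℕ)) : S = T := by
  have inj : Function.Injective (fun i : Fin n => (Fin.rev i : ℕ)) := by
    intro a b hab
    exact Fin.rev_injective (Fin.ext hab)
  apply Finset.image_injective inj
  apply Finset.geomSum_injective (n := 2) le_rfl
  simp only
  rw [sum_image (fun a _ b _ hab => inj hab), sum_image (fun a _ b _ hab => inj hab)]
  exact_mod_cast h

open Finset Filter Topology in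
lemma perturb {n : ℕ} (v : Finset (Fin n) → Prop) (h0 : ¬ v ∅) (q : ℝ) (w : Fin n → ℝ)
    (hw0 : ∀ i, 0 ≤ w i) (hw : ∀ i j, i ≤ j → w j ≤ w i)
    (h : ∀ S : Finset (Fin n), v S ↔ q ≤ ∑ i ∈ S, w i) :
    ∃ u : Fin n → ℝ, (∀ i, 0 ≤ u i) ∧ (∀ i j, i ≤ j → u j ≤ u i) ∧
      (∀ S, v S → q < ∑ i ∈ S, u i) ∧ (∀ S, ¬ v S → ∑ i ∈ S, u i < q) ∧
      ∀ S T : Finset (Fin n), ∑ i ∈ S, u i = ∑ i ∈ T, u i → S = T := by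
  set c : Fin n → ℝ := fun i => (2:ℝ)^(Fin.rev i : ℕ) with hc
  have hcpos : ∀ i, 0 < c i := fun i => by simp [hc]
  have hcinj : ∀ S T : Finset (Fin n), S ≠ T → ∑ i ∈ S, c i ≠ ∑ i ∈ T, c i :=
    fun S T hST e => hST (code_inj S T e)
  have hsum : ∀ (ε : ℝ) (S : Finset (Fin n)),
      ∑ i ∈ S, (w i + ε * c i) = ∑ i ∈ S, w i + ε * ∑ i ∈ S, c i := by
    intro ε S; rw [sum_add_distrib, mul_sum]
  have hcont : ∀ S : Finset (Fin n),
      Tendsto (fun ε : ℝ => ∑ i ∈ S, w i + ε * ∑ i ∈ S, c i) (𝓝[>] 0) (𝓝 (∑ i ∈ S, w i)) := by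
    intro S
    have : Continuous (fun ε : ℝ => ∑ i ∈ S, w i + ε * ∑ i ∈ S, c i) := by fun_prop
    have := this.tendsto 0
    simp only [zero_mul, add_zero] at this
    exact this.mono_left nhdsWithin_le_nhds
  have e1 : ∀ᶠ ε in 𝓝[>] (0:ℝ), 0 < ε := self_mem_nhdsWithin
  have e2 : ∀ᶠ ε in 𝓝[>] (0:ℝ), ∀ S, ¬ v S → ∑ i ∈ S, w i + ε * ∑ i ∈ S, c i < q := by
    rw [eventually_all]
    intro S
    by_cases hS : v S
    · simp [hS]
    · have : ∑ i ∈ S, w i < q := lt_of_not_ge (fun hh => hS ((h S).2 hh))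
      filter_upwards [(hcont S).eventually_lt_const this] with ε hε _ using hε
  have e3 : ∀ᶠ ε in 𝓝[>] (0:ℝ), ∀ S T : Finset (Fin n), S ≠ T →
      ∑ i ∈ S, w i + ε * ∑ i ∈ S, c i ≠ ∑ i ∈ T, w i + ε * ∑ i ∈ T, c i := by
    rw [eventually_all]
    intro S
    rw [eventually_all]
    intro T
    by_cases hST : ∑ i ∈ S, w i = ∑ i ∈ T, w i
    · filter_upwards [e1] with ε hε hne he
      apply hcinj S T hne
      rw [hST] at he
      exact mul_left_cancel₀ hε.ne' (add_left_cancel he)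
    · have := ((hcont S).sub (hcont T)).eventually_ne (sub_ne_zero.2 hST)
      filter_upwards [this] with ε hε _ he
      exact hε (sub_eq_zero.2 he)
  obtain ⟨ε, hε, h2, h3⟩ := (e1.and (e2.and e3)).exists
  refine ⟨fun i => w i + ε * c i, ?_, ?_, ?_, ?_, ?_⟩
  · intro i; have := hw0 i; have := mul_pos hε (hcpos i); linarith
  · intro i j hij
    have : c j ≤ c i := by
      simp only [hc]
      apply pow_le_pow_right₀ (by norm_num)
      exact_mod_cast Fin.rev_le_rev.2 hij
    have := mul_le_mul_of_nonneg_left this hε.le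
    linarith [hw i j hij]
  · intro S hS
    rw [hsum]
    have hne : S.Nonempty := by
      rw [nonempty_iff_ne_empty]; rintro rfl; exact h0 hS
    have := mul_pos hε (sum_pos (fun i _ => hcpos i) hne)
    linarith [(h S).1 hS]
  · intro S hS; rw [hsum]; exact h2 S hS
  · intro S T he
    by_contra hne
    rw [hsum, hsum] at he
    exact h3 S T hne he

lemma exists_mwc {n : ℕ} (v : Finset (Fin n) → Prop) (S : Finset (Fin n)) (hS : v S) :
    ∃ T ⊆ S, IsMWCv n v T := by
  induction S using Finset.strongInduction with
  | H S ih =>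
    by_cases hm : ∃ p ∈ S, v (S.erase p)
    · obtain ⟨p, hp, hvp⟩ := hm
      obtain ⟨T, hT, hT'⟩ := ih _ (Finset.erase_ssubset hp) hvp
      exact ⟨T, hT.trans (Finset.erase_subset _ _), hT'⟩
    · push Not at hm
      exact ⟨S, subset_rfl, hS, hm⟩

lemma strict_quota {α : Type} [Fintype α] (f : α → ℝ) (r : ℝ) :
    ∃ q, r < q ∧ ∀ a, r < f a ↔ q ≤ f a := by
  have : ∀ᶠ q in nhdsWithin r (Set.Ioi r), ∀ a, r < f a → q ≤ f a := by
    rw [Filter.eventually_all]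
    intro a
    by_cases ha : r < f a
    · have : ∀ᶠ q in nhdsWithin r (Set.Ioi r), q < f a :=
        Filter.Eventually.filter_mono nhdsWithin_le_nhds (eventually_lt_nhds ha)
      filter_upwards [this] with q hq _ using hq.le
    · simp [ha]
  have e1 : ∀ᶠ q in nhdsWithin r (Set.Ioi r), r < q := self_mem_nhdsWithin
  obtain ⟨q, h1, h2⟩ := (e1.and this).exists
  exact ⟨q, h1, fun a => ⟨h2 a, fun h => h1.trans_le h⟩⟩

open Finset Classical in
theorem stmt14 (n : ℕ) (v : Finset (Fin n) → Prop) (hv : IsCWVGv n v)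
    (hne : ∃ S, IsMWCv n v S) :
    ∃ C : Finset (Fin n), IsMWCv n v C ∧
      ∃ v' : Finset (Fin n) → Prop, IsCWVGv n v' ∧
        ∀ S : Finset (Fin n), IsMWCv n v' S ↔ (IsMWCv n v S ∧ S ≠ C) := by
  obtain ⟨q, w, hw0, hwa, hrep⟩ := sorted_rep v hv
  have hd := hv.2
  have hmono : ∀ S T : Finset (Fin n), S ⊆ T → v S → v T := by
    intro S T hST hS
    rw [hrep] at hS ⊢
    exact hS.trans (sum_le_sum_of_subset_of_nonneg hST (fun i _ _ => hw0 i))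
  by_cases h0 : v ∅
  · refine ⟨∅, ⟨h0, by simp⟩, fun _ => False,
      ⟨⟨1, fun _ => 0, zero_le_one, fun _ => le_rfl, fun S => by simp⟩,
        fun i j _ S _ _ h => h⟩, fun S => ⟨fun h => h.1.elim, ?_⟩⟩
    rintro ⟨hS, hne'⟩
    obtain ⟨p, hp⟩ := nonempty_iff_ne_empty.2 hne'
    exact (hS.2 p hp (hmono _ _ (empty_subset _) h0)).elim
  obtain ⟨u0, hu0, hu0a, hu0w, hu0l, hu0i⟩ := perturb v h0 q w hw0 hwa hrep
  set A : Finset (Fin n) := univ.filter (fun i => ∃ S, IsMWCv n v S ∧ i ∈ S) with hA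
  have hAm : ∀ i, i ∈ A ↔ ∃ S, IsMWCv n v S ∧ i ∈ S := by intro i; simp [hA]
  have hMA : ∀ S, IsMWCv n v S → S ⊆ A := fun S hS i hi => (hAm i).2 ⟨S, hS, hi⟩
  have hvA : ∀ S, v S → v (S ∩ A) := by
    intro S hS
    obtain ⟨T, hT, hTm⟩ := exists_mwc v S hS
    exact hmono T _ (subset_inter hT (hMA T hTm)) hTm.1
  have hAne : A.Nonempty := by
    obtain ⟨S, hS⟩ := hne
    have : S.Nonempty := by
      rw [nonempty_iff_ne_empty]; rintro rfl; exact h0 hS.1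
    exact this.mono (hMA S hS)
  obtain ⟨m, hmA, hmax⟩ : ∃ m ∈ A, ∀ i ∈ A, i ≤ m :=
    ⟨A.max' hAne, A.max'_mem hAne, fun i hi => A.le_max' i hi⟩
  -- zero out the dummies
  set u : Fin n → ℝ := fun i => if i ∈ A then u0 i else 0 with hu
  have husum : ∀ S : Finset (Fin n), ∑ i ∈ S, u i = ∑ i ∈ S ∩ A, u0 i := by
    intro S
    rw [hu, sum_ite_mem]
  have hun : ∀ i, 0 ≤ u i := by
    intro i; simp only [hu]; split_ifs; exacts [hu0 i, le_rfl]
  have huw : ∀ S, v S → q < ∑ i ∈ S, u i := fun S hS => by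
    rw [husum]; exact hu0w _ (hvA S hS)
  have hul : ∀ S, ¬ v S → ∑ i ∈ S, u i < q := fun S hS => by
    rw [husum]; exact hu0l _ (fun hh => hS (hmono _ _ inter_subset_left hh))
  -- the lightest MWC containing m
  obtain ⟨C, ⟨hC, hmC⟩, hmin⟩ : ∃ C, (IsMWCv n v C ∧ m ∈ C) ∧
      ∀ T, IsMWCv n v T → m ∈ T → ∑ i ∈ C, u i ≤ ∑ i ∈ T, u i := by
    obtain ⟨S, hS⟩ := (hAm m).1 hmA
    obtain ⟨C, hC, hmin⟩ := exists_min_image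
      (univ.filter (fun T : Finset (Fin n) => IsMWCv n v T ∧ m ∈ T))
      (fun T => ∑ i ∈ T, u i) ⟨S, by simpa using hS⟩
    refine ⟨C, by simpa using hC, fun T h1 h2 => hmin T (by simp [h1, h2])⟩
  have hCA : C ∩ A = C := inter_eq_left.2 (hMA C hC)
  have hswap : ∀ p ∈ A, p ∉ C → v (insert p (C.erase m)) := by
    intro p hp hpC
    refine hd p m (hmax p hp) (C.erase m) (by simp [hpC]) (by simp) ?_
    rw [insert_erase hmC]; exact hC.1
  set t : ℝ := ∑ i ∈ C, u i - q with ht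
  have ht0 : 0 < t := by rw [ht]; linarith [huw C hC.1]
  have htm : t ≤ u m := by
    have := hul _ (hC.2 m hmC)
    have e := add_sum_erase C u hmC
    rw [ht]; linarith
  set u' : Fin n → ℝ := fun i => u i - if i = m then t else 0 with hu'
  have hu'sum : ∀ S : Finset (Fin n), ∑ i ∈ S, u' i = ∑ i ∈ S, u i - if m ∈ S then t else 0 := by
    intro S
    rw [hu', sum_sub_distrib, sum_ite_eq']
  have hu'n : ∀ i, 0 ≤ u' i := by
    intro i; simp only [hu']
    split_ifs with hi
    · subst hi; linarith
    · linarith [hun i]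
  have hu'a : ∀ i j, i ≤ j → u' j ≤ u' i := by
    intro i j hij
    rcases eq_or_lt_of_le hij with rfl | hlt
    · exact le_rfl
    by_cases hjA : j ∈ A
    · have hiA : i ∈ A := by
        obtain ⟨T, hT, hjT⟩ := (hAm j).1 hjA
        by_contra hiA
        have hiT : i ∉ T := fun hh => hiA ((hAm i).2 ⟨T, hT, hh⟩)
        have := hd i j hij (T.erase j) (by simp [hiT]) (by simp)
          (by rw [insert_erase hjT]; exact hT.1)
        have h2 := hvA _ this
        rw [insert_inter_of_notMem hiA] at h2
        exact hT.2 j hjT (hmono _ _ inter_subset_left h2)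
      have him : i ≠ m := (hlt.trans_le (hmax j hjA)).ne
      have := hu0a i j hij
      simp only [hu', hu, hiA, hjA, him, if_true, if_false]
      split_ifs <;> linarith
    · have hjm : j ≠ m := by rintro rfl; exact hjA hmA
      have : u' j = 0 := by simp [hu', hu, hjA, hjm]
      rw [this]; exact hu'n i
  have hrep' : ∀ S, (v S ∧ S ∩ A ≠ C) ↔ q < ∑ i ∈ S, u' i := by
    intro S
    rw [hu'sum]
    constructor
    · rintro ⟨hS, hSC⟩
      by_cases hmS : m ∈ S
      · rw [if_pos hmS]
        by_cases hSm : v (S.erase m)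
        · have := huw _ hSm
          have e := add_sum_erase S u hmS
          linarith
        · obtain ⟨T, hTS, hT⟩ := exists_mwc v S hS
          have hmT : m ∈ T := by
            by_contra hmT
            exact hSm (hmono T _ (subset_erase.2 ⟨hTS, hmT⟩) hT.1)
          have hTC : T ≠ C := by
            rintro rfl
            apply hSC
            apply Subset.antisymm _ (subset_inter hTS (hMA _ hC))
            intro p hp
            rw [mem_inter] at hp
            by_contra hpC
            apply hSm
            refine hmono _ _ ?_ (hswap p hp.2 hpC)
            rw [insert_subset_iff]
            refine ⟨mem_erase.2 ⟨?_, hp.1⟩, erase_subset_erase _ hTS⟩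
            rintro rfl; exact hpC hmC
          have hlt : ∑ i ∈ C, u i < ∑ i ∈ T, u i := by
            apply lt_of_le_of_ne (hmin T hT hmT)
            intro e
            rw [husum, husum] at e
            have := hu0i _ _ e
            rw [hCA, inter_eq_left.2 (hMA T hT)] at this
            exact hTC this.symm
          have := sum_le_sum_of_subset_of_nonneg hTS (fun i _ _ => hun i)
          rw [ht]; linarith
      · rw [if_neg hmS]; linarith [huw S hS]
    · intro hlt
      constructor
      · by_contra hS
        have := hul S hS
        split_ifs at hlt <;> linarith
      · intro hSC
        have hmS : m ∈ S := (mem_inter.1 (hSC ▸ hmC : m ∈ S ∩ A)).1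
        have e : ∑ i ∈ S, u i = ∑ i ∈ C, u i := by rw [husum, husum, hSC, hCA]
        rw [if_pos hmS, e, ht] at hlt
        linarith
  obtain ⟨q', hq', hqq⟩ := strict_quota (fun S : Finset (Fin n) => ∑ i ∈ S, u' i) q
  have hq0 : 0 ≤ q := by have := hul ∅ h0; simp at this; exact this.le
  have hfin : ∀ S, (v S ∧ S ∩ A ≠ C) ↔ q' ≤ ∑ i ∈ S, u' i := fun S => (hrep' S).trans (hqq S)
  refine ⟨C, hC, fun S => v S ∧ S ∩ A ≠ C,
    ⟨⟨q', u', hq0.trans hq'.le, hu'n, hfin⟩, desir_of_antitone _ q' u' hu'a hfin⟩, fun S => ?_⟩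
  constructor
  · rintro ⟨⟨hS, hSC⟩, hSm⟩
    refine ⟨⟨hS, fun p hp hvp => ?_⟩, fun e => hSC (by rw [e, hCA])⟩
    have h1 : S.erase p ∩ A = C := by
      by_contra hh; exact hSm p hp ⟨hvp, hh⟩
    have hCS : C ⊆ S.erase p := h1 ▸ inter_subset_left
    have hpC : p ∉ C := fun hh => by simpa using hCS hh
    have hpA : p ∈ A := by
      by_contra hpA
      apply hSC
      rw [← h1, erase_inter, erase_eq_of_notMem]
      simp [hpA]
    have hmS : m ∈ S := mem_of_mem_erase (hCS hmC)
    refine hSm m hmS ⟨hmono _ _ ?_ (hswap p hpA hpC), ?_⟩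
    · rw [insert_subset_iff]
      refine ⟨mem_erase.2 ⟨?_, hp⟩, erase_subset_erase _ (hCS.trans (erase_subset _ _))⟩
      rintro rfl; exact hpC hmC
    · intro e
      have : m ∈ S.erase m ∩ A := e ▸ hmC
      simp at this
  · rintro ⟨hS, hSC⟩
    refine ⟨⟨hS.1, ?_⟩, fun p hp h => hS.2 p hp h.1⟩
    rw [inter_eq_left.2 (hMA S hS)]; exact hSC
end

section
/- For every n ≥ 4, the poset (G_cwvg(n), ⪯_MWC) is not a tree: there exist canonical weighted voting games G, G', G'' on n players with G' ≠ G'' such that the MWC set of G' and the MWC set of G'' are both subsets of the MWC set of G of cardinality exactly one less, i.e., G covers two distinct games. -/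
/-- The type of canonical weighted voting games on `n` players. -/
abbrev CWVG (n : ℕ) := {v : Finset (Fin n) → Prop // IsCWVGv n v}

/-- The set of minimal winning coalitions of a canonical weighted voting game. -/
def mwcSet (n : ℕ) (G : CWVG n) : Set (Finset (Fin n)) :=
  {S | IsMWCv n G.1 S}

/-- The simple game whose winning coalitions contain a member of `F`. -/
def genGame {n : ℕ} (F : Finset (Finset (Fin n))) (S : Finset (Fin n)) : Prop :=
  ∃ T ∈ F, T ⊆ S

theorem genGame_mwc {n : ℕ} (F : Finset (Finset (Fin n))) (hF : ∀ T ∈ F, T.card = 2) :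
    {S | IsMWCv n (genGame F) S} = (F : Set (Finset (Fin n))) := by
  ext S
  simp only [Set.mem_setOf_eq, Finset.mem_coe]
  constructor
  · rintro ⟨⟨T, hT, hTS⟩, hmin⟩
    by_cases h : T = S
    · exact h ▸ hT
    · exfalso
      obtain ⟨p, hp, hpT⟩ := Finset.exists_of_ssubset (hTS.ssubset_of_ne h)
      exact hmin p hp ⟨T, hT, Finset.subset_erase.2 ⟨hTS, hpT⟩⟩
  · intro hS
    refine ⟨⟨S, hS, subset_rfl⟩, ?_⟩
    rintro p hp ⟨T, hT, hTS⟩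
    have h1 := Finset.card_le_card hTS
    have h2 := Finset.card_erase_lt_of_mem hp
    rw [hF T hT] at h1
    rw [hF S hS] at h2
    omega

theorem cwvg_of_weights {n : ℕ} (v : Finset (Fin n) → Prop) (q : ℝ) (w : Fin n → ℝ)
    (hq : 0 ≤ q) (hw : ∀ i, 0 ≤ w i) (hv : ∀ S, v S ↔ q ≤ ∑ i ∈ S, w i)
    (hanti : ∀ i j, i ≤ j → w j ≤ w i) : IsCWVGv n v := by
  refine ⟨⟨q, w, hq, hw, hv⟩, ?_⟩
  intro i j hij S hi hj h
  rw [hv, Finset.sum_insert hj] at h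
  rw [hv, Finset.sum_insert hi]
  linarith [hanti i j hij]

/-- Weights `a, b, c, d` for the first four players, zero for the others. -/
def wt {n : ℕ} (a b c d : ℝ) (i : Fin n) : ℝ :=
  if i.val = 0 then a else if i.val = 1 then b else if i.val = 2 then c
  else if i.val = 3 then d else 0

theorem wt_nonneg {n : ℕ} {a b c d : ℝ} (ha : b ≤ a) (hb : c ≤ b) (hc : d ≤ c) (hd : 0 ≤ d)
    (i : Fin n) : 0 ≤ wt a b c d i := by
  unfold wt
  split_ifs <;> linarith

theorem wt_anti {n : ℕ} {a b c d : ℝ} (ha : b ≤ a) (hb : c ≤ b) (hc : d ≤ c) (hd : 0 ≤ d)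
    (i j : Fin n) (hij : i ≤ j) : wt a b c d j ≤ wt a b c d i := by
  have h : i.val ≤ j.val := hij
  unfold wt
  split_ifs <;> first | linarith | (exfalso; omega)

open Classical in
theorem wt_sum {n : ℕ} (hn : 4 ≤ n) (a b c d : ℝ) (S : Finset (Fin n)) :
    ∑ i ∈ S, wt a b c d i =
      (if (⟨0, by omega⟩ : Fin n) ∈ S then a else 0) + (if (⟨1, by omega⟩ : Fin n) ∈ S then b else 0)
      + (if (⟨2, by omega⟩ : Fin n) ∈ S then c else 0)
      + (if (⟨3, by omega⟩ : Fin n) ∈ S then d else 0) := by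
  have h : ∀ i : Fin n, wt a b c d i =
      (if i = (⟨0, by omega⟩ : Fin n) then a else 0) + (if i = (⟨1, by omega⟩ : Fin n) then b else 0)
      + (if i = (⟨2, by omega⟩ : Fin n) then c else 0)
      + (if i = (⟨3, by omega⟩ : Fin n) then d else 0) := by
    intro i
    simp only [wt, Fin.ext_iff]
    split_ifs <;> first | (exfalso; omega) | simp
  simp only [h, Finset.sum_add_distrib, Finset.sum_ite_eq']

theorem stmt16 (n : ℕ) (hn : 4 ≤ n) :
    ∃ G G' G'' : CWVG n, G' ≠ G'' ∧
      mwcSet n G' ⊆ mwcSet n G ∧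
      (mwcSet n G').ncard + 1 = (mwcSet n G).ncard ∧
      mwcSet n G'' ⊆ mwcSet n G ∧
      (mwcSet n G'').ncard + 1 = (mwcSet n G).ncard := by
  have hs := wt_sum hn
  obtain ⟨p0, h0⟩ : ∃ p : Fin n, p = ⟨0, by omega⟩ := ⟨_, rfl⟩
  obtain ⟨p1, h1⟩ : ∃ p : Fin n, p = ⟨1, by omega⟩ := ⟨_, rfl⟩
  obtain ⟨p2, h2⟩ : ∃ p : Fin n, p = ⟨2, by omega⟩ := ⟨_, rfl⟩
  obtain ⟨p3, h3⟩ : ∃ p : Fin n, p = ⟨3, by omega⟩ := ⟨_, rfl⟩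
  rw [← h0, ← h1, ← h2, ← h3] at hs
  have h01 : p0 ≠ p1 := by simp [h0, h1]
  have h02 : p0 ≠ p2 := by simp [h0, h2]
  have h03 : p0 ≠ p3 := by simp [h0, h3]
  have h12 : p1 ≠ p2 := by simp [h1, h2]
  have h13 : p1 ≠ p3 := by simp [h1, h3]
  have h23 : p2 ≠ p3 := by simp [h2, h3]
  clear h0 h1 h2 h3
  let A : Finset (Fin n) := {p0, p1}
  let B : Finset (Fin n) := {p0, p2}
  let C : Finset (Fin n) := {p0, p3}
  let D : Finset (Fin n) := {p1, p2}
  have cA : A.card = 2 := Finset.card_pair h01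
  have cB : B.card = 2 := Finset.card_pair h02
  have cC : C.card = 2 := Finset.card_pair h03
  have cD : D.card = 2 := Finset.card_pair h12
  have hAB : A ≠ B := fun h => by
    have : p1 ∈ B := h ▸ (by simp [A])
    simp [B, h01.symm, h12] at this
  have hAC : A ≠ C := fun h => by
    have : p1 ∈ C := h ▸ (by simp [A])
    simp [C, h01.symm, h13] at this
  have hAD : A ≠ D := fun h => by
    have : p0 ∈ D := h ▸ (by simp [A])
    simp [D, h01, h02] at this
  have hBC : B ≠ C := fun h => by
    have : p2 ∈ C := h ▸ (by simp [B])
    simp [C, h02.symm, h23] at this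
  have hBD : B ≠ D := fun h => by
    have : p0 ∈ D := h ▸ (by simp [B])
    simp [D, h01, h02] at this
  have hCD : C ≠ D := fun h => by
    have : p0 ∈ D := h ▸ (by simp [C])
    simp [D, h01, h02] at this
  have g : IsCWVGv n (genGame {A, B, C, D}) := by
    refine cwvg_of_weights _ 4 (wt 3 2 2 1) (by norm_num)
      (wt_nonneg (by norm_num) (by norm_num) (by norm_num) (by norm_num)) ?_
      (wt_anti (by norm_num) (by norm_num) (by norm_num) (by norm_num))
    intro S
    rw [hs]
    by_cases m0 : p0 ∈ S <;> by_cases m1 : p1 ∈ S <;> by_cases m2 : p2 ∈ S <;>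
      by_cases m3 : p3 ∈ S <;>
      norm_num [genGame, A, B, C, D, Finset.insert_subset_iff, m0, m1, m2, m3]
  have g' : IsCWVGv n (genGame {A, B, D}) := by
    refine cwvg_of_weights _ 2 (wt 1 1 1 0) (by norm_num)
      (wt_nonneg (by norm_num) (by norm_num) (by norm_num) (by norm_num)) ?_
      (wt_anti (by norm_num) (by norm_num) (by norm_num) (by norm_num))
    intro S
    rw [hs]
    by_cases m0 : p0 ∈ S <;> by_cases m1 : p1 ∈ S <;> by_cases m2 : p2 ∈ S <;>
      by_cases m3 : p3 ∈ S <;>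
      norm_num [genGame, A, B, C, D, Finset.insert_subset_iff, m0, m1, m2, m3]
  have g'' : IsCWVGv n (genGame {A, B, C}) := by
    refine cwvg_of_weights _ 4 (wt 3 1 1 1) (by norm_num)
      (wt_nonneg (by norm_num) (by norm_num) (by norm_num) (by norm_num)) ?_
      (wt_anti (by norm_num) (by norm_num) (by norm_num) (by norm_num))
    intro S
    rw [hs]
    by_cases m0 : p0 ∈ S <;> by_cases m1 : p1 ∈ S <;> by_cases m2 : p2 ∈ S <;>
      by_cases m3 : p3 ∈ S <;>
      norm_num [genGame, A, B, C, D, Finset.insert_subset_iff, m0, m1, m2, m3]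
  have e : mwcSet n ⟨_, g⟩ = _ := genGame_mwc {A, B, C, D} (by simp [cA, cB, cC, cD])
  have e' : mwcSet n ⟨_, g'⟩ = _ := genGame_mwc {A, B, D} (by simp [cA, cB, cD])
  have e'' : mwcSet n ⟨_, g''⟩ = _ := genGame_mwc {A, B, C} (by simp [cA, cB, cC])
  clear_value A B C D
  refine ⟨⟨_, g⟩, ⟨_, g'⟩, ⟨_, g''⟩, ?_, ?_, ?_, ?_, ?_⟩
  · intro h
    have h4 : D ∈ mwcSet n ⟨_, g''⟩ := by
      rw [← h, e']
      simp
    rw [e''] at h4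
    simp [hAD.symm, hBD.symm, hCD.symm] at h4
  · rw [e, e', Finset.coe_subset]
    intro x
    simp only [Finset.mem_insert, Finset.mem_singleton]
    tauto
  · rw [e, e', Set.ncard_coe_finset, Set.ncard_coe_finset]
    simp [hAB, hAC, hAD, hBC, hBD, hCD]
  · rw [e, e'', Finset.coe_subset]
    intro x
    simp only [Finset.mem_insert, Finset.mem_singleton]
    tauto
  · rw [e, e'', Set.ncard_coe_finset, Set.ncard_coe_finset]
    simp [hAB, hAC, hAD, hBC, hBD, hCD]
end
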